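/- arXiv:1705.08007 — 4 statements merged into one kernel-verified Lean document; each statement's English description precedes it below -/
import Mathlib

section
/- Let p ≥ 2 be real. For every u ∈ C_c^∞(ℝ^N; ℂ) one has | Im ∫_{ℝ^N} Au(x) · conj(u(x)) |u(x)|^{p−2} dx | ≤ |p−2| · B · C + |α−b| · C · D, where B² = ∫_{ℝ^N} (1+|x|^α)|u|^{p−4}|Re(conj(u)∇u)|² dx, C² = ∫_{ℝ^N} (1+|x|^α)|u|^{p−4}|Im(conj(u)∇u)|² dx and D² = ∫_{ℝ^N} |x|^{α−2}|u|^p dx, the integrands containing |u|^{p−4} being understood to vanish at points where u = 0. -/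
open Real MeasureTheory Metric
open scoped ENNReal NNReal

/-- The `i`-th partial derivative of `u` at `x`. -/
noncomputable def pd {N : ℕ} {F : Type*} [NormedAddCommGroup F] [NormedSpace ℝ F]
    (u : EuclideanSpace ℝ (Fin N) → F) (i : Fin N) (x : EuclideanSpace ℝ (Fin N)) : F :=
  fderiv ℝ u x (EuclideanSpace.single i 1)

/-- The Laplacian of `u` at `x`. -/
noncomputable def lap {N : ℕ} {F : Type*} [NormedAddCommGroup F] [NormedSpace ℝ F]
    (u : EuclideanSpace ℝ (Fin N) → F) (x : EuclideanSpace ℝ (Fin N)) : F :=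
  ∑ i, pd (pd u i) i x

/-- The elliptic operator `Au = (1+|x|^α)Δu + b|x|^{α-2} x·∇u - c|x|^β u` acting on
complex-valued functions (real and imaginary parts separately). -/
noncomputable def opAC {N : ℕ} (α β b c : ℝ) (u : EuclideanSpace ℝ (Fin N) → ℂ)
    (x : EuclideanSpace ℝ (Fin N)) : ℂ :=
  ((1 + ‖x‖ ^ α : ℝ) : ℂ) * lap u x
    + ((b * ‖x‖ ^ (α - 2) : ℝ) : ℂ) * (∑ i, ((x i : ℝ) : ℂ) * pd u i x)
    - ((c * ‖x‖ ^ β : ℝ) : ℂ) * u x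

lemma aux_cs {X : Type*} [MeasurableSpace X] {μ : Measure X} {f F G : X → ℝ}
    (hF : Integrable F μ) (hG : Integrable G μ) (hF0 : ∀ x, 0 ≤ F x) (hG0 : ∀ x, 0 ≤ G x)
    (h : ∀ x, f x ^ 2 ≤ F x * G x) :
    |∫ x, f x ∂μ| ≤ Real.sqrt (∫ x, F x ∂μ) * Real.sqrt (∫ x, G x ∂μ) := by
  have key : ∀ H : X → ℝ, Integrable H μ → (∀ x, 0 ≤ H x) →
      MemLp (fun x => Real.sqrt (H x)) 2 μ := by
    intro H hH hH0
    rw [memLp_two_iff_integrable_sq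
      (Real.continuous_sqrt.comp_aestronglyMeasurable hH.aestronglyMeasurable)]
    simpa [Real.sq_sqrt, hH0] using hH
  have h1 : |∫ x, f x ∂μ| ≤ ∫ x, Real.sqrt (F x) * Real.sqrt (G x) ∂μ := by
    rw [← Real.norm_eq_abs]
    refine norm_integral_le_of_norm_le ((key F hF hF0).integrable_mul (key G hG hG0))
      (Filter.Eventually.of_forall fun x => ?_)
    rw [Real.norm_eq_abs, ← Real.sqrt_mul (hF0 x)]
    exact Real.abs_le_sqrt (h x)
  refine h1.trans ?_
  have h2 := integral_mul_le_Lp_mul_Lq_of_nonneg (μ := μ) (p := 2) (q := 2)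
    (f := fun x => Real.sqrt (F x)) (g := fun x => Real.sqrt (G x)) Real.HolderConjugate.two_two
    (Filter.Eventually.of_forall fun x => Real.sqrt_nonneg _)
    (Filter.Eventually.of_forall fun x => Real.sqrt_nonneg _)
    (by simpa using key F hF hF0) (by simpa using key G hG hG0)
  simpa [Real.sq_sqrt, hF0, hG0, Real.sqrt_eq_rpow (∫ x, F x ∂μ),
    Real.sqrt_eq_rpow (∫ x, G x ∂μ)] using h2

/-- product rule where the first factor is only continuous, and the second vanishes. -/
lemma aux_mul_zero {E : Type*} [NormedAddCommGroup E] [NormedSpace ℝ E] {f g : E → ℝ}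
    {g' : E →L[ℝ] ℝ} {x : E} (hf : ContinuousAt f x) (hg : HasFDerivAt g g' x) (h0 : g x = 0) :
    HasFDerivAt (fun y => f y * g y) (f x • g') x := by
  have h1 : HasFDerivAt (fun y => (f y - f x) * g y) (0 : E →L[ℝ] ℝ) x := by
    rw [hasFDerivAt_iff_isLittleO]
    have hO : g =O[nhds x] fun y => y - x := by
      simpa [h0] using hg.isBigO_sub
    have ho : (fun y => f y - f x) =o[nhds x] fun _ => (1 : ℝ) := by
      rw [Asymptotics.isLittleO_one_iff]
      simpa using hf.sub_const (f x)
    have := ho.mul_isBigO hO.norm_right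
    simpa [h0] using this
  have h2 := h1.add (hg.const_mul (f x))
  refine (h2.congr_fderiv (by simp)).congr_of_eventuallyEq
    (Filter.Eventually.of_forall fun y => ?_)
  simp only [Pi.add_apply]; ring

lemma aux_norm_rpow {E : Type*} [NormedAddCommGroup E] [NormedSpace ℝ E] {u : E → ℂ}
    {u' : E →L[ℝ] ℂ} {x : E} (hu : HasFDerivAt u u' x) (h0 : u x ≠ 0) (q : ℝ) :
    HasFDerivAt (fun y => ‖u y‖ ^ q) ((q * ‖u x‖ ^ (q - 2)) • (innerSL ℝ (u x)).comp u') x := by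
  have h := hu.norm_sq.rpow_const (p := q / 2) (Or.inl (by simpa using h0))
  have e : ∀ (t : ℝ) (r : ℝ), 0 ≤ t → (t ^ 2) ^ r = t ^ (2 * r) := by
    intro t r ht
    rw [Real.rpow_mul ht]; norm_num
  refine (h.congr_fderiv ?_).congr_of_eventuallyEq (Filter.Eventually.of_forall fun y => ?_)
  · ext v
    simp only [smul_apply, smul_eq_mul, nsmul_eq_mul]
    rw [e _ _ (norm_nonneg _), show 2 * (q / 2 - 1) = q - 2 by ring]
    push_cast; ring
  · simp only []
    rw [e _ _ (norm_nonneg _), show 2 * (q / 2) = q by ring]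

section main
variable {N : ℕ} {u : EuclideanSpace ℝ (Fin N) → ℂ}

lemma aux_pd_contDiff (hu : ContDiff ℝ (⊤ : ℕ∞) u) (i : Fin N) :
    ContDiff ℝ (⊤ : ℕ∞) (pd u i) := by
  have : ContDiff ℝ (⊤ : ℕ∞) (fderiv ℝ u) := hu.fderiv_right (by simp)
  exact this.clm_apply contDiff_const

/-- derivative of `|u|^{p-2} Im (conj u ∂_i u)` -/
lemma aux_hderiv (hu : ContDiff ℝ (⊤ : ℕ∞) u) {p : ℝ} (hp : 2 ≤ p) (i : Fin N)
    (x : EuclideanSpace ℝ (Fin N)) :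
    ∃ L : EuclideanSpace ℝ (Fin N) →L[ℝ] ℝ,
      HasFDerivAt (fun y => ‖u y‖ ^ (p - 2) * ((starRingEnd ℂ) (u y) * pd u i y).im) L x ∧
      L (EuclideanSpace.single i 1) =
        (p - 2) * (‖u x‖ ^ (p - 4) * (((starRingEnd ℂ) (u x) * pd u i x).re *
          ((starRingEnd ℂ) (u x) * pd u i x).im))
        + ‖u x‖ ^ (p - 2) * ((starRingEnd ℂ) (u x) * pd (pd u i) i x).im := by
  have hd : HasFDerivAt u (fderiv ℝ u x) x := (hu.differentiable (by simp) x).hasFDerivAt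
  have hd2 : HasFDerivAt (pd u i) (fderiv ℝ (pd u i) x) x :=
    ((aux_pd_contDiff hu i).differentiable (by simp) x).hasFDerivAt
  have hw := Complex.imCLM.hasFDerivAt.comp x
    ((Complex.conjCLE.toContinuousLinearMap.hasFDerivAt.comp x hd).mul hd2)
  have hwv : ∀ L, L = (Complex.imCLM.comp ((((Complex.conjCLE.toContinuousLinearMap) ∘ u) x) •
        fderiv ℝ (pd u i) x
        + pd u i x • (Complex.conjCLE.toContinuousLinearMap).comp (fderiv ℝ u x))) →
      L (EuclideanSpace.single i 1) = ((starRingEnd ℂ) (u x) * pd (pd u i) i x).im := by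
    rintro L rfl
    have : fderiv ℝ u x (EuclideanSpace.single i 1) = pd u i x := rfl
    have h2 : fderiv ℝ (pd u i) x (EuclideanSpace.single i 1) = pd (pd u i) i x := rfl
    simp [this, h2]
    ring
  have hwv := hwv _ rfl
  by_cases h0 : u x = 0
  · refine ⟨_, aux_mul_zero (f := fun y => ‖u y‖ ^ (p - 2)) ?_ hw ?_, ?_⟩
    · exact ((hu.continuous.norm.rpow_const (fun _ => Or.inr (by linarith)))).continuousAt
    · simp [h0]
    · rw [smul_apply, hwv]
      simp [h0]
  · refine ⟨_, (aux_norm_rpow hd h0 (p - 2)).mul hw, ?_⟩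
    rw [add_apply, smul_apply,
      smul_apply, hwv]
    have : fderiv ℝ u x (EuclideanSpace.single i 1) = pd u i x := rfl
    simp [this, Complex.inner]
    rw [show p - 2 - 2 = p - 4 by ring]
    ring

lemma aux_int {F : Type*} [NormedAddCommGroup F] (hsupp : HasCompactSupport u)
    {f : EuclideanSpace ℝ (Fin N) → F} (hf : Continuous f)
    (h : ∀ x, x ∉ tsupport u → f x = 0) : Integrable f :=
  hf.integrable_of_hasCompactSupport (HasCompactSupport.intro hsupp h)

lemma aux_pd_zero (i : Fin N) {x : EuclideanSpace ℝ (Fin N)} (hx : x ∉ tsupport u) :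
    pd u i x = 0 := by
  simp [pd, fderiv_of_notMem_tsupport ℝ hx]

/-- integrability of the singular products -/
lemma aux_sing (hu : ContDiff ℝ (⊤ : ℕ∞) u) (hsupp : HasCompactSupport u) {p α : ℝ} (hp : 2 ≤ p)
    (hα : 2 < α) (i : Fin N) (S T : ℂ → ℝ) (hSm : Continuous S) (hTm : Continuous T)
    (hS : ∀ z, |S z| ≤ ‖z‖) (hT : ∀ z, |T z| ≤ ‖z‖) :
    Integrable (fun x => (1 + ‖x‖ ^ α) * (‖u x‖ ^ (p - 4) *
      (S ((starRingEnd ℂ) (u x) * pd u i x) * T ((starRingEnd ℂ) (u x) * pd u i x)))) := by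
  have hc := hu.continuous
  have hpc := (aux_pd_contDiff hu i).continuous
  have hcc : Continuous fun x => (starRingEnd ℂ) (u x) := Complex.continuous_conj.comp hc
  have hdom : Integrable (fun x => (1 + ‖x‖ ^ α) * (‖u x‖ ^ (p - 2) * ‖pd u i x‖ ^ 2)) := by
    refine aux_int hsupp ?_ ?_
    · exact (continuous_const.add (continuous_norm.rpow_const fun _ => Or.inr (by linarith))).mul
        ((hc.norm.rpow_const fun _ => Or.inr (by linarith)).mul (hpc.norm.pow 2))
    · intro x hx
      simp [aux_pd_zero i hx]
  refine hdom.mono' ?_ (Filter.Eventually.of_forall fun x => ?_)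
  · refine Measurable.aestronglyMeasurable ?_
    have m1 := (hSm.comp (hcc.mul hpc)).measurable
    have m2 := (hTm.comp (hcc.mul hpc)).measurable
    have m3 : Measurable fun x => ‖u x‖ ^ (p - 4) := hc.norm.measurable.pow_const _
    have m4 : Measurable fun x : EuclideanSpace ℝ (Fin N) => 1 + ‖x‖ ^ α :=
      (measurable_norm.pow_const _).const_add _
    exact m4.mul (m3.mul (m1.mul m2))
  · have ha : 0 ≤ 1 + ‖x‖ ^ α := by positivity
    have hr : 0 ≤ ‖u x‖ ^ (p - 4) := by positivity
    rw [Real.norm_eq_abs, abs_mul, abs_mul, abs_mul, abs_of_nonneg ha, abs_of_nonneg hr]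
    refine mul_le_mul_of_nonneg_left ?_ ha
    set z := (starRingEnd ℂ) (u x) * pd u i x with hz
    have hzn : ‖z‖ = ‖u x‖ * ‖pd u i x‖ := by simp [hz]
    have h1 : |S z| * |T z| ≤ ‖u x‖ ^ 2 * ‖pd u i x‖ ^ 2 := by
      calc |S z| * |T z| ≤ ‖z‖ * ‖z‖ := mul_le_mul (hS z) (hT z) (abs_nonneg _) (norm_nonneg _)
        _ = _ := by rw [hzn]; ring
    by_cases h0 : u x = 0
    · have : |S z| * |T z| = 0 := le_antisymm (by simpa [h0] using h1) (by positivity)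
      rw [this, mul_zero]; positivity
    · refine (mul_le_mul_of_nonneg_left h1 hr).trans_eq ?_
      rw [← mul_assoc, ← Real.rpow_natCast ‖u x‖ 2, ← Real.rpow_add (norm_pos_iff.2 h0)]
      congr 2; push_cast; ring

lemma aux_cont_a {α : ℝ} (hα : 0 ≤ α) :
    Continuous fun x : EuclideanSpace ℝ (Fin N) => ‖x‖ ^ α :=
  continuous_norm.rpow_const fun _ => Or.inr hα

lemma aux_int_lap (hu : ContDiff ℝ (⊤ : ℕ∞) u) (hsupp : HasCompactSupport u) {p α : ℝ}
    (hp : 2 ≤ p) (hα : 2 < α) (i : Fin N) :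
    Integrable (fun x => (1 + ‖x‖ ^ α) *
      (‖u x‖ ^ (p - 2) * ((starRingEnd ℂ) (u x) * pd (pd u i) i x).im)) := by
  have hc := hu.continuous
  have hpc := (aux_pd_contDiff (aux_pd_contDiff hu i) i).continuous
  refine aux_int hsupp ?_ ?_
  · exact (continuous_const.add (aux_cont_a (by linarith))).mul
      ((hc.norm.rpow_const fun _ => Or.inr (by linarith)).mul
        (Complex.continuous_im.comp ((Complex.continuous_conj.comp hc).mul hpc)))
  · intro x hx
    simp [image_eq_zero_of_notMem_tsupport hx]

lemma aux_int_drift (hu : ContDiff ℝ (⊤ : ℕ∞) u) (hsupp : HasCompactSupport u) {p α : ℝ}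
    (hp : 2 ≤ p) (hα : 2 < α) (i : Fin N) :
    Integrable (fun x => ‖x‖ ^ (α - 2) * x i *
      (‖u x‖ ^ (p - 2) * ((starRingEnd ℂ) (u x) * pd u i x).im)) := by
  have hc := hu.continuous
  have hpc := (aux_pd_contDiff hu i).continuous
  refine aux_int hsupp ?_ ?_
  · exact ((aux_cont_a (by linarith)).mul (by fun_prop)).mul
      ((hc.norm.rpow_const fun _ => Or.inr (by linarith)).mul
        (Complex.continuous_im.comp ((Complex.continuous_conj.comp hc).mul hpc)))
  · intro x hx
    simp [image_eq_zero_of_notMem_tsupport hx]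

lemma aux_ibp (hu : ContDiff ℝ (⊤ : ℕ∞) u) (hsupp : HasCompactSupport u) {p α : ℝ}
    (hp : 2 ≤ p) (hα : 2 < α) (i : Fin N) :
    ∫ x, (1 + ‖x‖ ^ α) * (‖u x‖ ^ (p - 2) * ((starRingEnd ℂ) (u x) * pd (pd u i) i x).im) =
      -((p - 2) * ∫ x, (1 + ‖x‖ ^ α) * (‖u x‖ ^ (p - 4) *
          (((starRingEnd ℂ) (u x) * pd u i x).re * ((starRingEnd ℂ) (u x) * pd u i x).im)))
      - α * ∫ x, ‖x‖ ^ (α - 2) * x i *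
          (‖u x‖ ^ (p - 2) * ((starRingEnd ℂ) (u x) * pd u i x).im) := by
  have hc := hu.continuous
  have hpc := (aux_pd_contDiff hu i).continuous
  have i1 := aux_int_lap hu hsupp hp hα i
  have i2 := aux_sing hu hsupp hp hα i Complex.re Complex.im Complex.continuous_re
    Complex.continuous_im Complex.abs_re_le_norm Complex.abs_im_le_norm
  have i3 := aux_int_drift hu hsupp hp hα i
  have ha : ∀ x : EuclideanSpace ℝ (Fin N), HasFDerivAt (fun y => 1 + ‖y‖ ^ α)
      ((α * ‖x‖ ^ (α - 2)) • innerSL ℝ x) x := fun x =>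
    (hasFDerivAt_norm_rpow x (by linarith)).const_add 1
  have ha' : ∀ x : EuclideanSpace ℝ (Fin N), fderiv ℝ (fun y => 1 + ‖y‖ ^ α) x
      (EuclideanSpace.single i 1) = α * (‖x‖ ^ (α - 2) * x i) := by
    intro x
    rw [(ha x).fderiv]
    simp [EuclideanSpace.inner_single_right, mul_assoc]
  choose L hL hLv using aux_hderiv hu hp i
  have hf' : ∀ x, fderiv ℝ
      (fun y => ‖u y‖ ^ (p - 2) * ((starRingEnd ℂ) (u y) * pd u i y).im) x
      (EuclideanSpace.single i 1) = _ := fun x => by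
    rw [(hL x).fderiv, hLv x]
  have key := integral_mul_fderiv_eq_neg_fderiv_mul_of_integrable
    (μ := (volume : Measure (EuclideanSpace ℝ (Fin N))))
    (f := fun y : EuclideanSpace ℝ (Fin N) => 1 + ‖y‖ ^ α)
    (g := fun y => ‖u y‖ ^ (p - 2) * ((starRingEnd ℂ) (u y) * pd u i y).im)
    (v := EuclideanSpace.single i 1) ?_ ?_ ?_ (fun x _ => (ha x).differentiableAt)
    (fun x _ => (hL x).differentiableAt)
  · simp_rw [ha', hf'] at key
    have e1 : ∀ x : EuclideanSpace ℝ (Fin N), (1 + ‖x‖ ^ α) *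
        ((p - 2) * (‖u x‖ ^ (p - 4) * (((starRingEnd ℂ) (u x) * pd u i x).re *
          ((starRingEnd ℂ) (u x) * pd u i x).im))
        + ‖u x‖ ^ (p - 2) * ((starRingEnd ℂ) (u x) * pd (pd u i) i x).im) =
        (p - 2) * ((1 + ‖x‖ ^ α) * (‖u x‖ ^ (p - 4) * (((starRingEnd ℂ) (u x) * pd u i x).re *
          ((starRingEnd ℂ) (u x) * pd u i x).im))) + (1 + ‖x‖ ^ α) *
        (‖u x‖ ^ (p - 2) * ((starRingEnd ℂ) (u x) * pd (pd u i) i x).im) := fun x => by ring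
    have e2 : ∀ x : EuclideanSpace ℝ (Fin N), α * (‖x‖ ^ (α - 2) * x i) *
          (‖u x‖ ^ (p - 2) * ((starRingEnd ℂ) (u x) * pd u i x).im) =
        α * (‖x‖ ^ (α - 2) * x i *
          (‖u x‖ ^ (p - 2) * ((starRingEnd ℂ) (u x) * pd u i x).im)) := fun x => by ring
    simp_rw [e1, e2] at key
    rw [integral_add (i2.const_mul _) i1, integral_const_mul, integral_const_mul] at key
    linarith
  · simp_rw [ha']
    refine (i3.const_mul α).congr (Filter.Eventually.of_forall fun x => ?_)
    simp only []; ring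
  · simp_rw [hf']
    refine ((i2.const_mul (p - 2)).add i1).congr (Filter.Eventually.of_forall fun x => ?_)
    simp only [Pi.add_apply]; ring
  · refine aux_int hsupp ?_ ?_
    · exact (continuous_const.add (aux_cont_a (by linarith))).mul
        ((hc.norm.rpow_const fun _ => Or.inr (by linarith)).mul
          (Complex.continuous_im.comp ((Complex.continuous_conj.comp hc).mul hpc)))
    · intro x hx
      simp [image_eq_zero_of_notMem_tsupport hx]

lemma aux_int_main (hu : ContDiff ℝ (⊤ : ℕ∞) u) (hsupp : HasCompactSupport u) {p α β b c : ℝ}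
    (hp : 2 ≤ p) (hα : 2 < α) (hβ : 0 ≤ β) :
    Integrable (fun x => opAC α β b c u x * (starRingEnd ℂ) (u x) *
      ((‖u x‖ ^ (p - 2) : ℝ) : ℂ)) := by
  have hc := hu.continuous
  have hcc : Continuous fun x => (starRingEnd ℂ) (u x) := Complex.continuous_conj.comp hc
  have c1 : Continuous fun x : EuclideanSpace ℝ (Fin N) => ((1 + ‖x‖ ^ α : ℝ) : ℂ) :=
    Complex.continuous_ofReal.comp (continuous_const.add (aux_cont_a (by linarith)))
  have c2 : Continuous fun x : EuclideanSpace ℝ (Fin N) => ((b * ‖x‖ ^ (α - 2) : ℝ) : ℂ) :=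
    Complex.continuous_ofReal.comp (continuous_const.mul (aux_cont_a (by linarith)))
  have c3 : Continuous fun x : EuclideanSpace ℝ (Fin N) => ((c * ‖x‖ ^ β : ℝ) : ℂ) :=
    Complex.continuous_ofReal.comp (continuous_const.mul (aux_cont_a hβ))
  have c4 : Continuous fun x => ((‖u x‖ ^ (p - 2) : ℝ) : ℂ) :=
    Complex.continuous_ofReal.comp (hc.norm.rpow_const fun _ => Or.inr (by linarith))
  have c5 : Continuous (lap u) := continuous_finsetSum _ fun i _ =>
    (aux_pd_contDiff (aux_pd_contDiff hu i) i).continuous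
  have c6 : Continuous fun x : EuclideanSpace ℝ (Fin N) => ∑ i, ((x i : ℝ) : ℂ) * pd u i x :=
    continuous_finsetSum _ fun i _ =>
      (Complex.continuous_ofReal.comp (by fun_prop)).mul (aux_pd_contDiff hu i).continuous
  refine aux_int hsupp ?_ ?_
  · exact ((((c1.mul c5).add (c2.mul c6)).sub (c3.mul hc)).mul hcc).mul c4
  · intro x hx
    simp [image_eq_zero_of_notMem_tsupport hx]

lemma aux_im (α β b c p : ℝ) (x : EuclideanSpace ℝ (Fin N)) :
    (opAC α β b c u x * (starRingEnd ℂ) (u x) * ((‖u x‖ ^ (p - 2) : ℝ) : ℂ)).im =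
      (∑ i, (1 + ‖x‖ ^ α) *
        (‖u x‖ ^ (p - 2) * ((starRingEnd ℂ) (u x) * pd (pd u i) i x).im)) +
      b * ∑ i, ‖x‖ ^ (α - 2) * x i *
          (‖u x‖ ^ (p - 2) * ((starRingEnd ℂ) (u x) * pd u i x).im) := by
  have e1 : ∑ i, (1 + ‖x‖ ^ α) *
        (‖u x‖ ^ (p - 2) * ((starRingEnd ℂ) (u x) * pd (pd u i) i x).im) =
      (1 + ‖x‖ ^ α) * ‖u x‖ ^ (p - 2) * ((starRingEnd ℂ) (u x) * lap u x).im := by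
    rw [lap, Finset.mul_sum, Complex.im_sum, Finset.mul_sum]
    exact Finset.sum_congr rfl fun i _ => by ring
  have e2 : ∑ i, ‖x‖ ^ (α - 2) * x i *
          (‖u x‖ ^ (p - 2) * ((starRingEnd ℂ) (u x) * pd u i x).im) =
      ‖x‖ ^ (α - 2) * ‖u x‖ ^ (p - 2) *
        ((starRingEnd ℂ) (u x) * ∑ i, ((x i : ℝ) : ℂ) * pd u i x).im := by
    rw [Finset.mul_sum, Complex.im_sum, Finset.mul_sum]
    refine Finset.sum_congr rfl fun i _ => ?_
    simp
    ring
  rw [e1, e2, opAC]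
  generalize lap u x = A
  generalize (∑ i, ((x i : ℝ) : ℂ) * pd u i x) = B
  generalize ‖u x‖ ^ (p - 2) = t
  generalize ‖x‖ ^ (α - 2) = s
  generalize ‖x‖ ^ β = r
  generalize ‖x‖ ^ α = q
  generalize u x = z
  rw [Complex.im_mul_ofReal]
  simp only [Complex.mul_im, Complex.mul_re, Complex.ofReal_re, Complex.ofReal_im, Complex.add_re, Complex.add_im, Complex.sub_re, Complex.sub_im,
    Complex.conj_re, Complex.conj_im]
  ring

lemma aux_identity (hu : ContDiff ℝ (⊤ : ℕ∞) u) (hsupp : HasCompactSupport u) {p α β b c : ℝ}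
    (hp : 2 ≤ p) (hα : 2 < α) (hβ : 0 ≤ β) :
    (∫ x, opAC α β b c u x * (starRingEnd ℂ) (u x) * ((‖u x‖ ^ (p - 2) : ℝ) : ℂ)).im =
      -((p - 2) * ∫ x, ∑ i, (1 + ‖x‖ ^ α) * (‖u x‖ ^ (p - 4) *
          (((starRingEnd ℂ) (u x) * pd u i x).re * ((starRingEnd ℂ) (u x) * pd u i x).im)))
      - (α - b) * ∫ x, ∑ i, ‖x‖ ^ (α - 2) * x i *
          (‖u x‖ ^ (p - 2) * ((starRingEnd ℂ) (u x) * pd u i x).im) := by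
  have h0 := Complex.imCLM.integral_comp_comm (aux_int_main (b := b) (c := c) hu hsupp hp hα hβ)
  simp only [Complex.imCLM_apply] at h0
  rw [← h0]
  simp_rw [aux_im]
  have j1 := fun i => aux_int_lap hu hsupp hp hα i
  have j3 := fun i => aux_int_drift hu hsupp hp hα i
  have j2 := fun i => aux_sing hu hsupp hp hα i Complex.re Complex.im Complex.continuous_re
    Complex.continuous_im Complex.abs_re_le_norm Complex.abs_im_le_norm
  rw [integral_add (integrable_finsetSum _ fun i _ => j1 i)
    ((integrable_finsetSum _ fun i _ => j3 i).const_mul b), integral_const_mul,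
    integral_finsetSum _ (fun i _ => j1 i), integral_finsetSum _ (fun i _ => j2 i),
    integral_finsetSum _ (fun i _ => j3 i)]
  simp_rw [aux_ibp hu hsupp hp hα]
  rw [Finset.sum_sub_distrib, Finset.sum_neg_distrib, ← Finset.mul_sum, ← Finset.mul_sum]
  ring

lemma aux_if (α p : ℝ) (S : ℂ → ℝ) (hS : S 0 = 0) (x : EuclideanSpace ℝ (Fin N)) :
    (1 + ‖x‖ ^ α) * (if u x = 0 then 0 else
            ‖u x‖ ^ (p - 4) * ∑ j, (S ((starRingEnd ℂ) (u x) * pd u j x)) ^ 2) =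
      ∑ j, (1 + ‖x‖ ^ α) * (‖u x‖ ^ (p - 4) * (S ((starRingEnd ℂ) (u x) * pd u j x) *
        S ((starRingEnd ℂ) (u x) * pd u j x))) := by
  split_ifs with h
  · simp [h, hS]
  · rw [Finset.mul_sum, Finset.mul_sum]
    exact Finset.sum_congr rfl fun i _ => by ring

lemma aux_drift_bound {α p : ℝ} (hα : 2 < α)
    (x : EuclideanSpace ℝ (Fin N)) :
    (∑ i, ‖x‖ ^ (α - 2) * x i *
          (‖u x‖ ^ (p - 2) * ((starRingEnd ℂ) (u x) * pd u i x).im)) ^ 2 ≤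
      (∑ i, (1 + ‖x‖ ^ α) * (‖u x‖ ^ (p - 4) * (((starRingEnd ℂ) (u x) * pd u i x).im *
        ((starRingEnd ℂ) (u x) * pd u i x).im))) * (‖x‖ ^ (α - 2) * ‖u x‖ ^ p) := by
  by_cases h0 : u x = 0
  · simp [h0]
  have hu0 : 0 < ‖u x‖ := norm_pos_iff.2 h0
  by_cases hx : x = 0
  · have : (0 : ℝ) ^ (α - 2) = 0 := Real.zero_rpow (by linarith)
    simp [hx, this]
  have hx0 : 0 < ‖x‖ := norm_pos_iff.2 hx
  set w : Fin N → ℝ := fun i => ((starRingEnd ℂ) (u x) * pd u i x).im with hw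
  have e1 : ∑ i, ‖x‖ ^ (α - 2) * x i * (‖u x‖ ^ (p - 2) * w i) =
      ‖x‖ ^ (α - 2) * ‖u x‖ ^ (p - 2) * ∑ i, x i * w i := by
    rw [Finset.mul_sum]
    exact Finset.sum_congr rfl fun i _ => by ring
  have e2 : ∑ i, (1 + ‖x‖ ^ α) * (‖u x‖ ^ (p - 4) * (w i * w i)) =
      (1 + ‖x‖ ^ α) * ‖u x‖ ^ (p - 4) * ∑ i, w i ^ 2 := by
    rw [Finset.mul_sum]
    exact Finset.sum_congr rfl fun i _ => by ring
  change (∑ i, ‖x‖ ^ (α - 2) * x i * (‖u x‖ ^ (p - 2) * w i)) ^ 2 ≤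
    (∑ i, (1 + ‖x‖ ^ α) * (‖u x‖ ^ (p - 4) * (w i * w i))) * _
  rw [e1, e2]
  have hcs := Finset.sum_mul_sq_le_sq_mul_sq Finset.univ (fun i => x i) w
  have hn : ∑ i, x i ^ 2 = ‖x‖ ^ 2 := by
    rw [EuclideanSpace.norm_sq_eq]; simp
  rw [hn] at hcs
  have r1 : (‖u x‖ ^ (p - 2)) ^ 2 = ‖u x‖ ^ (p - 4) * ‖u x‖ ^ p := by
    rw [sq, ← Real.rpow_add hu0, ← Real.rpow_add hu0]; congr 1; ring
  have r2 : ‖x‖ ^ (α - 2) * ‖x‖ ^ 2 = ‖x‖ ^ α := by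
    rw [← Real.rpow_natCast ‖x‖ 2, ← Real.rpow_add hx0]; congr 1; push_cast; ring
  have hW : 0 ≤ ∑ i, w i ^ 2 := Finset.sum_nonneg fun i _ => sq_nonneg _
  calc (‖x‖ ^ (α - 2) * ‖u x‖ ^ (p - 2) * ∑ i, x i * w i) ^ 2
      = (‖x‖ ^ (α - 2)) ^ 2 * (‖u x‖ ^ (p - 2)) ^ 2 * (∑ i, x i * w i) ^ 2 := by ring
    _ ≤ (‖x‖ ^ (α - 2)) ^ 2 * (‖u x‖ ^ (p - 2)) ^ 2 * (‖x‖ ^ 2 * ∑ i, w i ^ 2) := by gcongr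
    _ = (‖x‖ ^ (α - 2) * ‖x‖ ^ 2) * (‖x‖ ^ (α - 2) * (‖u x‖ ^ (p - 4) * ‖u x‖ ^ p) *
          ∑ i, w i ^ 2) := by rw [r1]; ring
    _ ≤ (1 + ‖x‖ ^ α) * (‖x‖ ^ (α - 2) * (‖u x‖ ^ (p - 4) * ‖u x‖ ^ p) *
          ∑ i, w i ^ 2) := by
        rw [r2]
        refine mul_le_mul_of_nonneg_right (by linarith) (by positivity)
    _ = _ := by ring

lemma aux_cross_bound {α p : ℝ} (x : EuclideanSpace ℝ (Fin N)) :
    (∑ i, (1 + ‖x‖ ^ α) * (‖u x‖ ^ (p - 4) * (((starRingEnd ℂ) (u x) * pd u i x).re *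
        ((starRingEnd ℂ) (u x) * pd u i x).im))) ^ 2 ≤
      (∑ i, (1 + ‖x‖ ^ α) * (‖u x‖ ^ (p - 4) * (((starRingEnd ℂ) (u x) * pd u i x).re *
        ((starRingEnd ℂ) (u x) * pd u i x).re))) *
      (∑ i, (1 + ‖x‖ ^ α) * (‖u x‖ ^ (p - 4) * (((starRingEnd ℂ) (u x) * pd u i x).im *
        ((starRingEnd ℂ) (u x) * pd u i x).im))) := by
  have hcs := Finset.sum_mul_sq_le_sq_mul_sq Finset.univ
    (fun i => ((starRingEnd ℂ) (u x) * pd u i x).re)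
    (fun i => ((starRingEnd ℂ) (u x) * pd u i x).im)
  simp_rw [← Finset.mul_sum]
  simp_rw [sq] at hcs ⊢
  have hk : 0 ≤ ((1 + ‖x‖ ^ α) * ‖u x‖ ^ (p - 4)) ^ 2 := by positivity
  have := mul_le_mul_of_nonneg_left hcs hk
  refine le_trans (le_of_eq ?_) (this.trans (le_of_eq ?_)) <;> ring

end main

/-- For `p ≥ 2` and `u ∈ C_c^∞(ℝ^N; ℂ)`:
`|Im ∫ Au · conj u · |u|^{p-2}| ≤ |p-2|·B·C + |α-b|·C·D`, where
`B² = ∫(1+|x|^α)|u|^{p-4}|Re(ū∇u)|²`, `C² = ∫(1+|x|^α)|u|^{p-4}|Im(ū∇u)|²` and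
`D² = ∫|x|^{α-2}|u|^p`, the integrands with `|u|^{p-4}` vanishing where `u = 0`. -/
theorem stmt10 (N : ℕ) (hN : 2 < N) (α β b c p : ℝ) (hα : 2 < α) (hβ : α - 2 < β)
    (hc : 0 < c) (hp : 2 ≤ p)
    (u : EuclideanSpace ℝ (Fin N) → ℂ) (hu : ContDiff ℝ (⊤ : ℕ∞) u) (hsupp : HasCompactSupport u) :
    |(∫ x, opAC α β b c u x * (starRingEnd ℂ) (u x) * ((‖u x‖ ^ (p - 2) : ℝ) : ℂ)).im| ≤
      |p - 2| *
        Real.sqrt (∫ x, (1 + ‖x‖ ^ α) *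
          (if u x = 0 then 0 else
            ‖u x‖ ^ (p - 4) * ∑ j, (((starRingEnd ℂ) (u x) * pd u j x).re) ^ 2)) *
        Real.sqrt (∫ x, (1 + ‖x‖ ^ α) *
          (if u x = 0 then 0 else
            ‖u x‖ ^ (p - 4) * ∑ j, (((starRingEnd ℂ) (u x) * pd u j x).im) ^ 2))
      + |α - b| *
        Real.sqrt (∫ x, (1 + ‖x‖ ^ α) *
          (if u x = 0 then 0 else
            ‖u x‖ ^ (p - 4) * ∑ j, (((starRingEnd ℂ) (u x) * pd u j x).im) ^ 2)) *
        Real.sqrt (∫ x, ‖x‖ ^ (α - 2) * ‖u x‖ ^ p) := by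
  have hS := fun (S T : ℂ → ℝ) hSm hTm hS hT => integrable_finsetSum Finset.univ
    fun i _ => aux_sing hu hsupp hp hα i S T hSm hTm hS hT
  have jr := hS Complex.re Complex.re Complex.continuous_re Complex.continuous_re
    Complex.abs_re_le_norm Complex.abs_re_le_norm
  have ji := hS Complex.im Complex.im Complex.continuous_im Complex.continuous_im
    Complex.abs_im_le_norm Complex.abs_im_le_norm
  have jd : Integrable fun x => ‖x‖ ^ (α - 2) * ‖u x‖ ^ p := by
    refine aux_int hsupp ?_ ?_
    · exact (aux_cont_a (by linarith)).mul
        (hu.continuous.norm.rpow_const fun _ => Or.inr (by linarith))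
    · intro x hx
      simp [image_eq_zero_of_notMem_tsupport hx, Real.zero_rpow (show p ≠ 0 by linarith)]
  have nn : ∀ (S : ℂ → ℝ) (x : EuclideanSpace ℝ (Fin N)),
      0 ≤ ∑ j, (1 + ‖x‖ ^ α) * (‖u x‖ ^ (p - 4) * (S ((starRingEnd ℂ) (u x) * pd u j x) *
        S ((starRingEnd ℂ) (u x) * pd u j x))) := fun S x =>
    Finset.sum_nonneg fun j _ => mul_nonneg (by positivity)
      (mul_nonneg (by positivity) (mul_self_nonneg _))
  simp_rw [aux_if α p Complex.re Complex.zero_re, aux_if α p Complex.im Complex.zero_im]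
  rw [aux_identity hu hsupp hp hα (by linarith)]
  have k1 := aux_cs jr ji (nn Complex.re) (nn Complex.im) aux_cross_bound
  have k2 := aux_cs ji jd (nn Complex.im) (fun x => by positivity)
    (aux_drift_bound (p := p) hα)
  have k1' := mul_le_mul_of_nonneg_left k1 (abs_nonneg (p - 2))
  have k2' := mul_le_mul_of_nonneg_left k2 (abs_nonneg (α - b))
  rw [← abs_mul] at k1' k2'
  refine (abs_sub _ _).trans ?_
  rw [abs_neg, mul_assoc, mul_assoc]
  exact add_le_add k1' k2'
end

section
/- Let p ≥ 2 be real. There exist constants ω > 0 and L > 0 such that for every u ∈ C_c^∞(ℝ^N; ℂ): Re ∫_{ℝ^N} (Au − ωu)(x) · conj(u(x)) |u(x)|^{p−2} dx ≤ 0 and | Im ∫_{ℝ^N} (Au − ωu)(x) · conj(u(x)) |u(x)|^{p−2} dx | ≤ L · ( − Re ∫_{ℝ^N} (Au − ωu)(x) · conj(u(x)) |u(x)|^{p−2} dx ). In particular, e^{±iθ}(A − ω) is dissipative on smooth compactly supported functions for 0 ≤ θ ≤ arctan(1/L). -/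
open Real MeasureTheory Metric
open scoped ENNReal NNReal

/-- The duality map `z ↦ conj z |z|^{p-2}`. -/
noncomputable def Fp (p : ℝ) (z : ℂ) : ℂ := (starRingEnd ℂ) z * ((‖z‖ ^ (p - 2) : ℝ) : ℂ)

/-- The directional derivative of `Fp`. -/
noncomputable def DF (p : ℝ) (z h : ℂ) : ℂ :=
  (starRingEnd ℂ) h * ((‖z‖ ^ (p - 2) : ℝ) : ℂ)
    + (((p - 2) * ‖z‖ ^ (p - 4) * ((starRingEnd ℂ) z * h).re : ℝ) : ℂ) * (starRingEnd ℂ) z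

lemma hasF (p : ℝ) (hp : 2 ≤ p) (z : ℂ) :
    ∃ L : ℂ →L[ℝ] ℂ, HasFDerivAt (Fp p) L z ∧ ∀ h, L h = DF p z h := by
  have hconj : HasFDerivAt (fun z : ℂ => (starRingEnd ℂ) z)
      (Complex.conjCLE : ℂ →L[ℝ] ℂ) z := Complex.conjCLE.hasFDerivAt
  rcases eq_or_lt_of_le hp with rfl | hp
  · refine ⟨Complex.conjCLE, ?_, ?_⟩
    · convert hconj using 1
      funext z
      simp [Fp]
    · intro h; simp [DF]
  by_cases hz : z = 0
  · subst hz
    refine ⟨0, ?_, ?_⟩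
    · rw [hasFDerivAt_iff_isLittleO_nhds_zero]
      have h0 : Fp p 0 = 0 := by simp [Fp]
      simp only [zero_add, h0, sub_zero, ContinuousLinearMap.zero_apply]
      have h1 : Filter.Tendsto (fun z : ℂ => ‖z‖ ^ (p - 2)) (nhds 0) (nhds 0) := by
        have : ContinuousAt (fun z : ℂ => ‖z‖ ^ (p - 2)) 0 :=
          (continuous_norm.rpow_const (fun _ => Or.inr (by linarith))).continuousAt
        simpa [ContinuousAt, Real.zero_rpow (by linarith : p - 2 ≠ 0)] using this
      have h2 : (fun z : ℂ => ‖z‖ ^ (p - 2)) =o[nhds 0] (fun _ : ℂ => (1 : ℝ)) :=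
        (Asymptotics.isLittleO_one_iff ℝ).2 h1
      have h3 := (Asymptotics.isBigO_refl (fun z : ℂ => ‖z‖) (nhds 0)).mul_isLittleO h2
      refine Asymptotics.IsLittleO.of_norm_right (Asymptotics.IsLittleO.of_norm_left ?_)
      refine (h3.congr (fun z => ?_) (fun z => by simp))
      simp [Fp, abs_of_nonneg (Real.rpow_nonneg (norm_nonneg z) _)]
    · intro h
      simp [DF, Real.zero_rpow (by linarith : p - 2 ≠ 0)]
  · have hn : HasFDerivAt (fun z : ℂ => (‖z‖ ^ 2) ^ ((p - 2) / 2))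
        ((((p - 2) / 2) * (‖z‖ ^ 2) ^ ((p - 2) / 2 - 1)) • (2 • innerSL ℝ z)) z :=
      (hasStrictFDerivAt_norm_sq z).hasFDerivAt.rpow_const (Or.inl (by simp [hz]))
    have e : ∀ (z : ℂ) (q : ℝ), (‖z‖ ^ 2) ^ (q / 2) = ‖z‖ ^ q := by
      intro z q
      rw [← Real.rpow_natCast_mul (norm_nonneg z)]
      congr 1; push_cast; ring
    have hn2 := (Complex.ofRealCLM.hasFDerivAt (x := (‖z‖ ^ 2) ^ ((p - 2) / 2))).comp z hn
    have hm := hconj.mul hn2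
    refine ⟨_, hm.congr_of_eventuallyEq (Filter.Eventually.of_forall fun w => ?_), ?_⟩
    · simp [Fp, e]
    · intro h
      have e2 : (‖z‖ ^ 2) ^ ((p - 2) / 2 - 1) = ‖z‖ ^ (p - 4) := by
        rw [← e]; congr 1; ring
      simp [DF, e, e2, Complex.inner]
      ring

lemma continuous_Fp (p : ℝ) (hp : 2 ≤ p) : Continuous (Fp p) := by
  unfold Fp
  refine Complex.continuous_conj.mul (Complex.continuous_ofReal.comp ?_)
  exact continuous_norm.rpow_const (fun _ => Or.inr (by linarith))

lemma rpow_aux (r q : ℝ) (hr : 0 ≤ r) (hq : 2 ≤ q) : r ^ q = r ^ (q - 2) * r ^ 2 := by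
  have := Real.rpow_add_natCast' (x := r) (y := q - 2) (n := 2) hr (by push_cast; linarith)
  rw [← this]; congr 1; push_cast; ring

lemma aux4 (p : ℝ) (z : ℂ) (hp : 2 ≤ p) :
    (p - 2) * ‖z‖ ^ (p - 4) * ‖z‖ ^ 2 = (p - 2) * ‖z‖ ^ (p - 2) := by
  rcases eq_or_lt_of_le hp with rfl | hp
  · simp
  have := Real.rpow_add_natCast' (x := ‖z‖) (y := p - 4) (n := 2) (norm_nonneg z)
    (by push_cast; linarith)
  rw [mul_assoc, ← this]; congr 2; push_cast; ring

lemma norm_DF (p : ℝ) (hp : 2 ≤ p) (z h : ℂ) :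
    ‖DF p z h‖ ≤ (p - 1) * (‖z‖ ^ (p - 2) * ‖h‖) := by
  have hs := Real.rpow_nonneg (norm_nonneg z) (p - 2)
  have hs4 := Real.rpow_nonneg (norm_nonneg z) (p - 4)
  have hR := Complex.abs_re_le_norm ((starRingEnd ℂ) z * h)
  rw [norm_mul, RCLike.norm_conj] at hR
  unfold DF
  refine (norm_add_le _ _).trans ?_
  rw [norm_mul, norm_mul, RCLike.norm_conj, RCLike.norm_conj, Complex.norm_real, Complex.norm_real,
    Real.norm_eq_abs, Real.norm_eq_abs, abs_of_nonneg hs, abs_mul,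
    abs_of_nonneg (mul_nonneg (by linarith : 0 ≤ p - 2) hs4)]
  have h1 : (p - 2) * ‖z‖ ^ (p - 4) * |((starRingEnd ℂ) z * h).re| * ‖z‖
      ≤ (p - 2) * ‖z‖ ^ (p - 4) * (‖z‖ * ‖h‖) * ‖z‖ := by
    have : 0 ≤ p - 2 := by linarith
    gcongr
  have h2 := aux4 p z hp
  have : (p - 2) * ‖z‖ ^ (p - 4) * (‖z‖ * ‖h‖) * ‖z‖ = (p - 2) * ‖z‖ ^ (p - 2) * ‖h‖ := by
    rw [← h2]; ring
  linarith

lemma DF_mul (p : ℝ) (hp : 2 ≤ p) (z h : ℂ) :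
    ‖z‖ ^ (p - 2) * ‖h‖ ^ 2 ≤ (DF p z h * h).re ∧
    |(DF p z h * h).im| ≤ (p - 2) * (‖z‖ ^ (p - 2) * ‖h‖ ^ 2) := by
  have hs4 := Real.rpow_nonneg (norm_nonneg z) (p - 4)
  have hp' : 0 ≤ p - 2 := by linarith
  set w := (starRingEnd ℂ) z * h with hw
  have e : DF p z h * h = ((‖z‖ ^ (p - 2) * ‖h‖ ^ 2 : ℝ) : ℂ)
      + (((p - 2) * ‖z‖ ^ (p - 4) * w.re : ℝ) : ℂ) * w := by
    have : (starRingEnd ℂ) h * h = ((‖h‖ ^ 2 : ℝ) : ℂ) := by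
      rw [Complex.conj_mul']; push_cast; rfl
    rw [Complex.ofReal_mul (‖z‖ ^ (p - 2)), ← this, DF, ← hw, hw]; ring
  have hwn : ‖w‖ = ‖z‖ * ‖h‖ := by rw [hw, norm_mul, RCLike.norm_conj]
  have hR := Complex.abs_re_le_norm w
  have hI := Complex.abs_im_le_norm w
  rw [hwn] at hR hI
  rw [e]
  constructor
  · rw [Complex.add_re, Complex.ofReal_re, Complex.re_ofReal_mul]
    have : 0 ≤ (p - 2) * ‖z‖ ^ (p - 4) * (w.re * w.re) :=
      mul_nonneg (mul_nonneg hp' hs4) (mul_self_nonneg _)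
    linarith
  · rw [Complex.add_im, Complex.ofReal_im, Complex.im_ofReal_mul, zero_add, abs_mul, abs_mul,
      abs_of_nonneg (mul_nonneg hp' hs4)]
    have h1 : (p - 2) * ‖z‖ ^ (p - 4) * |w.re| * |w.im|
      ≤ (p - 2) * ‖z‖ ^ (p - 4) * (‖z‖ * ‖h‖) * (‖z‖ * ‖h‖) := by gcongr
    have h2 := aux4 p z hp
    have : (p - 2) * ‖z‖ ^ (p - 4) * (‖z‖ * ‖h‖) * (‖z‖ * ‖h‖)
        = (p - 2) * ‖z‖ ^ (p - 2) * ‖h‖ ^ 2 := by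
      rw [← h2]; ring
    linarith

lemma exists_omega (α β c K : ℝ) (hα : 2 < α) (hβ : α - 2 < β) (hc : 0 < c) :
    ∃ ω : ℝ, 0 < ω ∧ ∀ r : ℝ, 0 ≤ r → K ^ 2 * r ^ (α - 2) ≤ c * r ^ β + ω := by
  set d := β - (α - 2) with hd
  have hd0 : 0 < d := by linarith
  set R := (K ^ 2 / c) ^ (1 / d) with hR
  have hq : 0 ≤ K ^ 2 / c := by positivity
  have hR0 : 0 ≤ R := Real.rpow_nonneg hq _
  refine ⟨K ^ 2 * R ^ (α - 2) + 1, by positivity, fun r hr => ?_⟩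
  rcases le_total r R with h | h
  · have : r ^ (α - 2) ≤ R ^ (α - 2) := Real.rpow_le_rpow hr h (by linarith)
    have h1 : K ^ 2 * r ^ (α - 2) ≤ K ^ 2 * R ^ (α - 2) := by gcongr
    have : 0 ≤ c * r ^ β := by positivity
    linarith
  · have h1 : K ^ 2 / c ≤ r ^ d := by
      have : R ^ d = K ^ 2 / c := by
        rw [hR, ← Real.rpow_mul hq, one_div, inv_mul_cancel₀ hd0.ne', Real.rpow_one]
      rw [← this]
      exact Real.rpow_le_rpow hR0 h hd0.le
    have h2 : r ^ β = r ^ d * r ^ (α - 2) := by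
      rw [← Real.rpow_add' hr (by rw [hd]; linarith)]
      congr 1; rw [hd]; ring
    have h3 : K ^ 2 ≤ c * r ^ d := by
      rw [div_le_iff₀ hc] at h1; linarith
    have h4 : 0 ≤ r ^ (α - 2) := by positivity
    have h5 : 0 ≤ R ^ (α - 2) := by positivity
    have h6 := mul_le_mul_of_nonneg_right h3 h4
    rw [h2]
    nlinarith [mul_nonneg (sq_nonneg K) h5]

section
variable {N : ℕ}

/-- The derivative in direction `i` of `(1 + |x|^α) Fp (u x)`. -/
noncomputable def DW (α p : ℝ) (u : EuclideanSpace ℝ (Fin N) → ℂ) (i : Fin N)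
    (x : EuclideanSpace ℝ (Fin N)) : ℂ :=
  ((1 + ‖x‖ ^ α : ℝ) : ℂ) * DF p (u x) (pd u i x)
    + ((α * ‖x‖ ^ (α - 2) * x i : ℝ) : ℂ) * Fp p (u x)

lemma hasW (α p : ℝ) (hα : 2 < α) (hp : 2 ≤ p) (u : EuclideanSpace ℝ (Fin N) → ℂ)
    (hu : Differentiable ℝ u) (i : Fin N) (x : EuclideanSpace ℝ (Fin N)) :
    DifferentiableAt ℝ (fun x => ((1 + ‖x‖ ^ α : ℝ) : ℂ) * Fp p (u x)) x ∧
    fderiv ℝ (fun x => ((1 + ‖x‖ ^ α : ℝ) : ℂ) * Fp p (u x)) x (EuclideanSpace.single i 1)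
      = DW α p u i x := by
  obtain ⟨L, hL, hL'⟩ := hasF p hp (u x)
  have h1 := hL.comp x (hu x).hasFDerivAt
  have h2 := (hasFDerivAt_norm_rpow x (by linarith : 1 < α)).const_add 1
  have h3 := (Complex.ofRealCLM.hasFDerivAt (x := 1 + ‖x‖ ^ α)).comp x h2
  have h4 := h3.mul h1
  have h5 : HasFDerivAt (fun x => ((1 + ‖x‖ ^ α : ℝ) : ℂ) * Fp p (u x)) _ x := h4
  refine ⟨h5.differentiableAt, ?_⟩
  rw [h5.fderiv]
  simp [DW, hL', pd, EuclideanSpace.inner_single_right]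
  ring

lemma contDiff_pd (u : EuclideanSpace ℝ (Fin N) → ℂ) (hu : ContDiff ℝ (⊤ : ℕ∞) u) (i : Fin N) :
    ContDiff ℝ (⊤ : ℕ∞) (pd u i) := by
  unfold pd
  exact (hu.fderiv_right (m := (⊤ : ℕ∞)) (by simp)).clm_apply contDiff_const

lemma cs_pd (u : EuclideanSpace ℝ (Fin N) → ℂ) (hu : HasCompactSupport u) (i : Fin N) :
    HasCompactSupport (pd u i) := by
  unfold pd
  exact hu.fderiv_apply (𝕜 := ℝ) _

lemma cont_a (α : ℝ) (hα : 0 ≤ α) :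
    Continuous (fun x : EuclideanSpace ℝ (Fin N) => ((‖x‖ ^ α : ℝ) : ℂ)) :=
  Complex.continuous_ofReal.comp (continuous_norm.rpow_const (fun _ => Or.inr hα))

lemma cont_x (i : Fin N) :
    Continuous (fun x : EuclideanSpace ℝ (Fin N) => ((x i : ℝ) : ℂ)) :=
  Complex.continuous_ofReal.comp (by fun_prop)

lemma int_parts (α p : ℝ) (hα : 2 < α) (hp : 2 ≤ p) (u : EuclideanSpace ℝ (Fin N) → ℂ)
    (hu : ContDiff ℝ (⊤ : ℕ∞) u) (hc : HasCompactSupport u) (i : Fin N) :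
    Integrable (fun x => DW α p u i x * pd u i x) ∧
    Integrable (fun x => ((1 + ‖x‖ ^ α : ℝ) : ℂ) * Fp p (u x) * pd (pd u i) i x) ∧
    ∫ x, ((1 + ‖x‖ ^ α : ℝ) : ℂ) * Fp p (u x) * pd (pd u i) i x
      = - ∫ x, DW α p u i x * pd u i x := by
  have hud : Differentiable ℝ u := hu.differentiable (by simp)
  have hv := contDiff_pd u hu i
  have hvc := cs_pd u hc i
  have hvd : Differentiable ℝ (pd u i) := hv.differentiable (by simp)
  have hvv := (contDiff_pd _ hv i).continuous
  have hvvc := cs_pd _ hvc i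
  have hW : Continuous (fun x => ((1 + ‖x‖ ^ α : ℝ) : ℂ) * Fp p (u x)) := by
    have := cont_a (N := N) α (by linarith)
    have h2 := (continuous_Fp p hp).comp hu.continuous
    simp only [Complex.ofReal_add, Complex.ofReal_one]
    exact (continuous_const.add this).mul h2
  have hfd : (fun x => fderiv ℝ (fun x => ((1 + ‖x‖ ^ α : ℝ) : ℂ) * Fp p (u x)) x
      (EuclideanSpace.single i 1)) = DW α p u i := by
    funext x; exact (hasW α p hα hp u hud i x).2
  have hmeas : Measurable (DW α p u i) := by
    rw [← hfd]; exact measurable_fderiv_apply_const ℝ _ _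
  have i2 : Integrable (fun x => ((1 + ‖x‖ ^ α : ℝ) : ℂ) * Fp p (u x) * pd (pd u i) i x) :=
    (hW.mul hvv).integrable_of_hasCompactSupport hvvc.mul_left
  have i3 : Integrable (fun x => ((1 + ‖x‖ ^ α : ℝ) : ℂ) * Fp p (u x) * pd u i x) :=
    (hW.mul hv.continuous).integrable_of_hasCompactSupport hvc.mul_left
  have i1 : Integrable (fun x => DW α p u i x * pd u i x) := by
    have hb : Integrable (fun x => ((1 + ‖x‖ ^ α) * ((p - 1) * (‖u x‖ ^ (p - 2) * ‖pd u i x‖))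
        + |α| * ‖x‖ ^ (α - 2) * ‖x i‖ * ‖Fp p (u x)‖) * ‖pd u i x‖) := by
      refine Continuous.integrable_of_hasCompactSupport ?_ (hvc.norm.mul_left)
      have c1 : Continuous (fun x : EuclideanSpace ℝ (Fin N) => ‖x‖ ^ α) :=
        continuous_norm.rpow_const (fun _ => Or.inr (by linarith))
      have c2 : Continuous (fun x : EuclideanSpace ℝ (Fin N) => ‖x‖ ^ (α - 2)) :=
        continuous_norm.rpow_const (fun _ => Or.inr (by linarith))
      have c3 : Continuous (fun x : EuclideanSpace ℝ (Fin N) => ‖u x‖ ^ (p - 2)) :=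
        hu.continuous.norm.rpow_const (fun _ => Or.inr (by linarith))
      have c4 := hv.continuous
      have c5 := (continuous_Fp p hp).comp hu.continuous
      have c6 : Continuous (fun x => ‖Fp p (u x)‖) := c5.norm
      fun_prop
    refine hb.mono' (hmeas.mul hv.continuous.measurable).aestronglyMeasurable
      (Filter.Eventually.of_forall fun x => ?_)
    rw [norm_mul]
    gcongr
    unfold DW
    refine (norm_add_le _ _).trans ?_
    rw [norm_mul, norm_mul, Complex.norm_real, Complex.norm_real, norm_mul, norm_mul]
    have hr1 : 0 ≤ ‖x‖ ^ α := by positivity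
    have hr2 : 0 ≤ ‖x‖ ^ (α - 2) := by positivity
    rw [Real.norm_of_nonneg (by linarith : 0 ≤ 1 + ‖x‖ ^ α), Real.norm_of_nonneg hr2,
      Real.norm_eq_abs α]
    gcongr
    exact norm_DF p hp _ _
  refine ⟨i1, i2, ?_⟩
  have key := integral_mul_fderiv_eq_neg_fderiv_mul_of_integrable (μ := volume)
    (f := fun x => ((1 + ‖x‖ ^ α : ℝ) : ℂ) * Fp p (u x)) (g := pd u i)
    (v := EuclideanSpace.single i 1) (by simpa only [congrFun hfd] using i1) i2 i3
    (fun x _ => (hasW α p hα hp u hud i x).1) (fun x _ => hvd x)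
  simp only [congrFun hfd] at key
  exact key

/-- The lower order terms. -/
noncomputable def Rest (α β b c p ω : ℝ) (u : EuclideanSpace ℝ (Fin N) → ℂ)
    (x : EuclideanSpace ℝ (Fin N)) : ℂ :=
  (((b * ‖x‖ ^ (α - 2) : ℝ) : ℂ) * (∑ i, ((x i : ℝ) : ℂ) * pd u i x)
    - ((c * ‖x‖ ^ β : ℝ) : ℂ) * u x - (ω : ℂ) * u x) * Fp p (u x)

lemma Fp_zero (p : ℝ) : Fp p 0 = 0 := by simp [Fp]

lemma int_rest (α β b c p ω : ℝ) (hα : 2 < α) (hβ : α - 2 < β) (hp : 2 ≤ p)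
    (u : EuclideanSpace ℝ (Fin N) → ℂ)
    (hu : ContDiff ℝ (⊤ : ℕ∞) u) (hc : HasCompactSupport u) :
    Integrable (Rest α β b c p ω u) := by
  have hF : Continuous (fun x => Fp p (u x)) := (continuous_Fp p hp).comp hu.continuous
  have hFc : HasCompactSupport (fun x => Fp p (u x)) := hc.comp_left (Fp_zero p)
  unfold Rest
  refine Continuous.integrable_of_hasCompactSupport ?_ hFc.mul_left
  have c1 := cont_a (N := N) (α - 2) (by linarith)
  have c2 := cont_a (N := N) β (by linarith)
  have c3 := fun i => cont_x (N := N) i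
  have c4 := fun i => (contDiff_pd u hu i).continuous
  have c5 := hu.continuous
  simp only [Complex.ofReal_mul]
  refine Continuous.mul ?_ hF
  refine ((Continuous.mul (continuous_const.mul c1) (continuous_finsetSum _ fun i _ =>
    (c3 i).mul (c4 i))).sub ((continuous_const.mul c2).mul c5)).sub (continuous_const.mul c5)

lemma pointwise (α β b c p ω : ℝ) (hα : 2 < α) (hp : 2 ≤ p) (hc : 0 < c) (hω0 : 0 < ω)
    (hω : ∀ r : ℝ, 0 ≤ r → (b - α) ^ 2 * r ^ (α - 2) ≤ c * r ^ β + ω)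
    (u : EuclideanSpace ℝ (Fin N) → ℂ) (x : EuclideanSpace ℝ (Fin N)) :
    (Rest α β b c p ω u x - ∑ i, DW α p u i x * pd u i x).re ≤ 0 ∧
    |(Rest α β b c p ω u x - ∑ i, DW α p u i x * pd u i x).im| ≤
      (2 * (p - 2) + 1) * -(Rest α β b c p ω u x - ∑ i, DW α p u i x * pd u i x).re := by
  set r := ‖x‖ with hr
  set s := ‖u x‖ with hs
  set S : ℂ := ∑ i, ((x i : ℝ) : ℂ) * pd u i x with hS
  set Q : ℂ := ∑ i, DF p (u x) (pd u i x) * pd u i x with hQ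
  set G : ℝ := ∑ i, ‖pd u i x‖ ^ 2 with hG
  have hr0 : 0 ≤ r := norm_nonneg _
  have hs0 : 0 ≤ s := norm_nonneg _
  have hG0 : 0 ≤ G := by positivity
  have huF : u x * Fp p (u x) = ((s ^ (p - 2) * s ^ 2 : ℝ) : ℂ) := by
    have : u x * (starRingEnd ℂ) (u x) = ((s ^ 2 : ℝ) : ℂ) := by
      rw [Complex.mul_conj']; push_cast; rfl
    rw [Complex.ofReal_mul, ← this, Fp]; ring
  have hFn : ‖Fp p (u x)‖ = s * s ^ (p - 2) := by
    rw [Fp, norm_mul, RCLike.norm_conj, Complex.norm_real,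
      Real.norm_of_nonneg (Real.rpow_nonneg (norm_nonneg _) _)]
  have hSn : ‖S‖ ≤ r * √G := by
    have h1 : ‖S‖ ≤ ∑ i, |x i| * ‖pd u i x‖ := by
      refine (norm_sum_le _ _).trans (le_of_eq ?_)
      refine Finset.sum_congr rfl fun i _ => ?_
      rw [norm_mul, Complex.norm_real, Real.norm_eq_abs]
    have h2 := Real.sum_mul_le_sqrt_mul_sqrt Finset.univ (fun i => |x i|) (fun i => ‖pd u i x‖)
    have h3 : √(∑ i, |x i| ^ 2) = r := by
      rw [hr, EuclideanSpace.norm_eq]; simp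
    rw [h3] at h2
    exact h1.trans h2
  have hQre : s ^ (p - 2) * G ≤ Q.re := by
    rw [hQ, hG, Complex.re_sum, Finset.mul_sum]
    exact Finset.sum_le_sum fun i _ => (DF_mul p hp _ _).1
  have hQim : |Q.im| ≤ (p - 2) * (s ^ (p - 2) * G) := by
    rw [hQ, hG, Complex.im_sum, Finset.mul_sum, Finset.mul_sum]
    exact (Finset.abs_sum_le_sum_abs _ _).trans
      (Finset.sum_le_sum fun i _ => (DF_mul p hp _ _).2)
  have hsum : ∑ i, DW α p u i x * pd u i x
      = ((1 + r ^ α : ℝ) : ℂ) * Q + ((α * r ^ (α - 2) : ℝ) : ℂ) * (S * Fp p (u x)) := by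
    rw [hQ, hS, Finset.mul_sum, Finset.sum_mul, Finset.mul_sum, ← Finset.sum_add_distrib]
    refine Finset.sum_congr rfl fun i _ => ?_
    rw [DW, Complex.ofReal_mul (α * ‖x‖ ^ (α - 2))]
    ring
  have hH : Rest α β b c p ω u x - ∑ i, DW α p u i x * pd u i x
      = (((b - α) * r ^ (α - 2) : ℝ) : ℂ) * (S * Fp p (u x))
        - ((1 + r ^ α : ℝ) : ℂ) * Q
        - (((c * r ^ β + ω) * (s ^ (p - 2) * s ^ 2) : ℝ) : ℂ) := by
    rw [hsum, Rest, Complex.ofReal_mul (c * r ^ β + ω), ← huF, ← hS]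
    push_cast
    ring
  set T := (((b - α) * r ^ (α - 2) : ℝ) : ℂ) * (S * Fp p (u x)) with hT
  have hra := rpow_aux r α hr0 hα.le
  set ra := r ^ (α - 2) with hra'
  set sp := s ^ (p - 2) with hsp'
  have hra0 : 0 ≤ ra := by positivity
  have hsp0 : 0 ≤ sp := by positivity
  have hrβ : 0 ≤ r ^ β := by positivity
  have hTn : ‖T‖ ≤ 1 / 2 * (r ^ α * (sp * G) + (c * r ^ β + ω) * (sp * s ^ 2)) := by
    have h1 : ‖T‖ ≤ |b - α| * ra * ((r * √G) * (s * sp)) := by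
      rw [hT, norm_mul, norm_mul, Complex.norm_real, hFn, norm_mul, Real.norm_eq_abs,
        Real.norm_of_nonneg hra0]
      gcongr
    have hq : √G ^ 2 = G := Real.sq_sqrt hG0
    have h2 : 0 ≤ (ra * sp) * (r * √G - |b - α| * s) ^ 2 := by positivity
    have h3 : (b - α) ^ 2 = |b - α| ^ 2 := (sq_abs _).symm
    have h4 := mul_le_mul_of_nonneg_right (hω r hr0) (by positivity : 0 ≤ sp * s ^ 2)
    rw [h3] at h4
    rw [hra, ← hq]
    nlinarith
  have hTr := (Complex.abs_re_le_norm T).trans hTn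
  have hTi := (Complex.abs_im_le_norm T).trans hTn
  have hrα : 0 ≤ r ^ α := by positivity
  have hE : 0 ≤ (c * r ^ β + ω) * (sp * s ^ 2) := by positivity
  have hA : (1 + r ^ α) * (sp * G) ≤ (1 + r ^ α) * Q.re :=
    mul_le_mul_of_nonneg_left hQre (by linarith)
  have hB : (1 + r ^ α) * |Q.im| ≤ (1 + r ^ α) * ((p - 2) * (sp * G)) :=
    mul_le_mul_of_nonneg_left hQim (by linarith)
  have hspG : 0 ≤ sp * G := by positivity
  have hM : 0 ≤ r ^ α * (sp * G) := by positivity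
  rw [hH]
  simp only [Complex.sub_re, Complex.sub_im, Complex.ofReal_re, Complex.ofReal_im,
    Complex.re_ofReal_mul, Complex.im_ofReal_mul, sub_zero]
  set E := (c * r ^ β + ω) * (sp * s ^ 2) with hEdef
  have hre1 := (abs_le.1 hTr).2
  have hlow : 1 / 2 * ((1 + r ^ α) * (sp * G) + E)
      ≤ -(T.re - (1 + r ^ α) * Q.re - E) := by linarith
  have hnn : 0 ≤ (1 + r ^ α) * (sp * G) + E := by linarith
  refine ⟨by linarith, ?_⟩
  have hi : |T.im - (1 + r ^ α) * Q.im| ≤ |T.im| + (1 + r ^ α) * |Q.im| := by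
    refine (abs_sub _ _).trans ?_
    rw [abs_mul, abs_of_nonneg (by linarith : 0 ≤ 1 + r ^ α)]
  have hp2 : 0 ≤ p - 2 := by linarith
  have h5 := mul_le_mul_of_nonneg_left hlow (by linarith : 0 ≤ 2 * (p - 2) + 1)
  have h6 : 0 ≤ (p - 2) * E := mul_nonneg hp2 hE
  refine le_trans ?_ h5
  nlinarith

end

/-- sectorial dissipativity. For real `p ≥ 2` there exist `ω > 0` and
`L > 0` such that for every `u ∈ C_c^∞(ℝ^N; ℂ)`:
`Re ∫ (Au - ωu) conj u |u|^{p-2} ≤ 0` and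
`|Im ∫ (Au - ωu) conj u |u|^{p-2}| ≤ L (-Re ∫ (Au - ωu) conj u |u|^{p-2})`. -/
theorem stmt11 (N : ℕ) (hN : 2 < N) (α β b c p : ℝ) (hα : 2 < α) (hβ : α - 2 < β)
    (hc : 0 < c) (hp : 2 ≤ p) :
    ∃ ω : ℝ, 0 < ω ∧ ∃ L : ℝ, 0 < L ∧
      ∀ u : EuclideanSpace ℝ (Fin N) → ℂ, ContDiff ℝ (⊤ : ℕ∞) u → HasCompactSupport u →
        (∫ x, (opAC α β b c u x - (ω : ℂ) * u x) * (starRingEnd ℂ) (u x)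
            * ((‖u x‖ ^ (p - 2) : ℝ) : ℂ)).re ≤ 0 ∧
        |(∫ x, (opAC α β b c u x - (ω : ℂ) * u x) * (starRingEnd ℂ) (u x)
            * ((‖u x‖ ^ (p - 2) : ℝ) : ℂ)).im| ≤
          L * (-(∫ x, (opAC α β b c u x - (ω : ℂ) * u x) * (starRingEnd ℂ) (u x)
            * ((‖u x‖ ^ (p - 2) : ℝ) : ℂ)).re) := by
  obtain ⟨ω, hω0, hω⟩ := exists_omega α β c (b - α) hα hβ hc
  refine ⟨ω, hω0, 2 * (p - 2) + 1, by linarith, fun u hu huc => ?_⟩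
  have hR := int_rest α β b c p ω hα hβ hp u hu huc
  have hI := int_parts α p hα hp u hu huc
  have hI1 : Integrable (fun x => ∑ i, DW α p u i x * pd u i x) :=
    integrable_finsetSum _ fun i _ => (hI i).1
  have hI2 : Integrable
      (fun x => ∑ i, ((1 + ‖x‖ ^ α : ℝ) : ℂ) * Fp p (u x) * pd (pd u i) i x) :=
    integrable_finsetSum _ fun i _ => (hI i).2.1
  have hH : Integrable (fun x => Rest α β b c p ω u x - ∑ i, DW α p u i x * pd u i x) :=
    hR.sub hI1
  have key : ∫ x, (opAC α β b c u x - (ω : ℂ) * u x) * (starRingEnd ℂ) (u x)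
            * ((‖u x‖ ^ (p - 2) : ℝ) : ℂ)
      = ∫ x, (Rest α β b c p ω u x - ∑ i, DW α p u i x * pd u i x) := by
    have e : ∀ x, (opAC α β b c u x - (ω : ℂ) * u x) * (starRingEnd ℂ) (u x)
            * ((‖u x‖ ^ (p - 2) : ℝ) : ℂ)
        = Rest α β b c p ω u x
          + ∑ i, ((1 + ‖x‖ ^ α : ℝ) : ℂ) * Fp p (u x) * pd (pd u i) i x := by
      intro x
      rw [← Finset.mul_sum]
      unfold opAC Rest Fp lap
      ring
    simp_rw [e]
    rw [integral_add hR hI2, integral_sub hR hI1, integral_finsetSum _ fun i _ => (hI i).2.1,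
      integral_finsetSum _ fun i _ => (hI i).1, sub_eq_add_neg, ← Finset.sum_neg_distrib]
    congr 1
    exact Finset.sum_congr rfl fun i _ => (hI i).2.2
  have pw := pointwise (N := N) α β b c p ω hα hp hc hω0 hω u
  rw [key]
  have hre := integral_re hH
  have him := integral_im hH
  simp only [RCLike.re_to_complex, RCLike.im_to_complex] at hre him
  rw [← hre, ← him]
  have hHre := hH.re
  have hHim := hH.im
  simp only [RCLike.re_to_complex, RCLike.im_to_complex] at hHre hHim
  refine ⟨integral_nonpos fun x => (pw x).1, ?_⟩
  rw [← integral_neg, ← integral_const_mul]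
  refine (abs_integral_le_integral_abs).trans ?_
  exact integral_mono hHim.abs (hHre.neg.const_mul _) fun x => (pw x).2
end

section
/- Assume β > α and let Ṽ(x) = c|x|^β / (1+|x|^α). Then Ṽ belongs to the reverse Hölder class B_q for every q ∈ (1, ∞); that is, for every 1 < q < ∞ there exists a constant C > 0 such that for every open ball B ⊂ ℝ^N: ( |B|^{−1} ∫_B Ṽ(x)^q dx )^{1/q} ≤ C · |B|^{−1} ∫_B Ṽ(x) dx, where |B| denotes the Lebesgue measure of B. -/
open Real MeasureTheory Metric

lemma aux_mono (α β c : ℝ) (hα : 2 < α) (hβ : α < β) (hc : 0 < c) (s t : ℝ) (hs : 0 ≤ s)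
    (hst : s ≤ t) : c * s ^ β / (1 + s ^ α) ≤ c * t ^ β / (1 + t ^ α) := by
  have ht : 0 ≤ t := hs.trans hst
  have hsa : 0 ≤ s ^ α := rpow_nonneg hs _
  have hta : 0 ≤ t ^ α := rpow_nonneg ht _
  have h1 : s ^ β = s ^ (β - α) * s ^ α := by
    rw [← rpow_add_of_nonneg hs (by linarith) (by linarith)]; congr 1; ring
  have h2 : t ^ β = t ^ (β - α) * t ^ α := by
    rw [← rpow_add_of_nonneg ht (by linarith) (by linarith)]; congr 1; ring
  have h3 : s ^ (β - α) ≤ t ^ (β - α) := rpow_le_rpow hs hst (by linarith)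
  have h4 : s ^ α ≤ t ^ α := rpow_le_rpow hs hst (by linarith)
  have h0 : 0 ≤ s ^ (β - α) := rpow_nonneg hs _
  rw [div_le_div_iff₀ (by linarith) (by linarith), h1, h2]
  have : s ^ (β - α) * (s ^ α * (1 + t ^ α)) ≤ t ^ (β - α) * (t ^ α * (1 + s ^ α)) := by
    apply mul_le_mul h3 (by nlinarith) (by positivity) (h0.trans h3)
  nlinarith

lemma aux_scale (α β c : ℝ) (hα : 2 < α) (hc : 0 < c) (t : ℝ) (ht : 0 ≤ t) :
    (1 / 4 : ℝ) ^ β * (c * t ^ β / (1 + t ^ α)) ≤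
      c * (t / 4) ^ β / (1 + (t / 4) ^ α) := by
  have h1 : (t / 4) ^ β = (1 / 4 : ℝ) ^ β * t ^ β := by
    rw [← mul_rpow (by norm_num) ht]; congr 1; ring
  have h2 : (t / 4) ^ α ≤ t ^ α := rpow_le_rpow (by positivity) (by linarith) (by linarith)
  have h3 : 0 ≤ (t / 4) ^ α := by positivity
  have h4 : 0 ≤ t ^ β := by positivity
  rw [h1, ← mul_div_assoc, show (1 / 4 : ℝ) ^ β * (c * t ^ β) = c * ((1 / 4 : ℝ) ^ β * t ^ β) by ring]
  exact div_le_div_of_nonneg_left (by positivity) (by linarith) (by linarith)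

/-- Assume `β > α` and let `Ṽ(x) = c|x|^β/(1+|x|^α)`. Then `Ṽ` belongs
to the reverse Hölder class `B_q` for every `q ∈ (1,∞)`: for every `1 < q < ∞` there is
`C > 0` such that for every ball `B = B(x,r)`,
`(|B|⁻¹ ∫_B Ṽ^q)^{1/q} ≤ C |B|⁻¹ ∫_B Ṽ`. -/
theorem stmt17 (N : ℕ) (hN : 2 < N) (α β c : ℝ) (hα : 2 < α) (hβ : α < β) (hc : 0 < c)
    (q : ℝ) (hq : 1 < q) :
    ∃ C : ℝ, 0 < C ∧ ∀ (x : EuclideanSpace ℝ (Fin N)) (r : ℝ), 0 < r →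
      ((volume (ball x r)).toReal⁻¹
          * ∫ y in ball x r, (c * ‖y‖ ^ β / (1 + ‖y‖ ^ α)) ^ q) ^ (1 / q) ≤
        C * ((volume (ball x r)).toReal⁻¹
          * ∫ y in ball x r, c * ‖y‖ ^ β / (1 + ‖y‖ ^ α)) := by
  have : NeZero N := ⟨by omega⟩
  have : Nontrivial (EuclideanSpace ℝ (Fin N)) :=
    Module.nontrivial_of_finrank_pos (R := ℝ) (by simp; omega)
  refine ⟨4 ^ N * 4 ^ β, by positivity, fun x r hr => ?_⟩
  set R : ℝ := ‖x‖ + r with hR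
  have hRpos : 0 < R := by positivity
  set M : ℝ := c * R ^ β / (1 + R ^ α) with hM
  have hMpos : 0 < M := by positivity
  set v : ℝ := (volume (ball x r)).toReal with hv
  have hvpos : 0 < v := ENNReal.toReal_pos (measure_ball_pos volume x hr).ne' measure_ball_lt_top.ne
  -- upper bound
  have hup : (v⁻¹ * ∫ y in ball x r, (c * ‖y‖ ^ β / (1 + ‖y‖ ^ α)) ^ q) ^ (1 / q) ≤ M := by
    have hb : ‖∫ y in ball x r, (c * ‖y‖ ^ β / (1 + ‖y‖ ^ α)) ^ q‖ ≤ M ^ q * v := by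
      apply norm_setIntegral_le_of_norm_le_const measure_ball_lt_top
      intro y hy
      rw [Real.norm_of_nonneg (by positivity)]
      apply rpow_le_rpow (by positivity) _ (by linarith)
      apply aux_mono α β c hα hβ hc _ _ (norm_nonneg _)
      have h1 : ‖y - x‖ < r := by simpa [dist_eq_norm] using hy
      have h2 := norm_le_norm_add_norm_sub' y x
      linarith
    have hnn : 0 ≤ ∫ y in ball x r, (c * ‖y‖ ^ β / (1 + ‖y‖ ^ α)) ^ q :=
      integral_nonneg fun y => by positivity
    have hle : v⁻¹ * ∫ y in ball x r, (c * ‖y‖ ^ β / (1 + ‖y‖ ^ α)) ^ q ≤ M ^ q := by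
      rw [inv_mul_le_iff₀ hvpos, mul_comm]
      exact (le_abs_self _).trans hb
    calc _ ≤ (M ^ q) ^ (1 / q) := rpow_le_rpow (by positivity) hle (by positivity)
      _ = M := by rw [← rpow_mul hMpos.le, mul_one_div_cancel (by linarith), rpow_one]
  refine hup.trans ?_
  obtain ⟨u, hu, hxu⟩ : ∃ u : EuclideanSpace ℝ (Fin N), ‖u‖ = 1 ∧ x = ‖x‖ • u := by
    by_cases hx : x = 0
    · obtain ⟨u, hu⟩ := exists_norm_eq (EuclideanSpace ℝ (Fin N)) zero_le_one
      exact ⟨u, hu, by simp [hx]⟩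
    · have : ‖x‖ ≠ 0 := by simpa using hx
      exact ⟨‖x‖⁻¹ • x, by simp [norm_smul, this], by simp [smul_smul, this]⟩
  set z : EuclideanSpace ℝ (Fin N) := (‖x‖ + r / 2) • u with hz
  have hzn : ‖z‖ = ‖x‖ + r / 2 := by
    rw [hz, norm_smul, hu, mul_one, Real.norm_of_nonneg (by positivity)]
  have hzx : dist z x = r / 2 := by
    have : z - x = (r / 2) • u := by
      rw [hz, add_smul, ← hxu, add_sub_cancel_left]
    rw [dist_eq_norm, this, norm_smul, hu, mul_one, Real.norm_of_nonneg (by positivity)]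
  have hsub : ball z (r / 4) ⊆ ball x r := ball_subset_ball' (by rw [hzx]; linarith)
  have hvz : (volume (ball z (r / 4))).toReal = (1 / 4) ^ N * v := by
    rw [hv, Measure.addHaar_ball volume z (by positivity), Measure.addHaar_ball volume x hr.le,
      ENNReal.toReal_mul, ENNReal.toReal_mul, ENNReal.toReal_ofReal (by positivity),
      ENNReal.toReal_ofReal (by positivity), finrank_euclideanSpace_fin]
    rw [show r / 4 = 1 / 4 * r by ring, mul_pow, mul_assoc]
  have hcont : Continuous fun y : EuclideanSpace ℝ (Fin N) => c * ‖y‖ ^ β / (1 + ‖y‖ ^ α) := by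
    have h1 : Continuous fun y : EuclideanSpace ℝ (Fin N) => ‖y‖ ^ β :=
      continuous_norm.rpow_const fun _ => Or.inr (by linarith)
    have h2 : Continuous fun y : EuclideanSpace ℝ (Fin N) => ‖y‖ ^ α :=
      continuous_norm.rpow_const fun _ => Or.inr (by linarith)
    exact (continuous_const.mul h1).div (continuous_const.add h2) fun y => by positivity
  have hint : IntegrableOn (fun y : EuclideanSpace ℝ (Fin N) => c * ‖y‖ ^ β / (1 + ‖y‖ ^ α))
      (ball x r) :=
    (hcont.continuousOn.integrableOn_compact (isCompact_closedBall x r)).mono_set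
      ball_subset_closedBall
  have hlow : (1 / 4 : ℝ) ^ β * M * ((1 / 4) ^ N * v) ≤
      ∫ y in ball x r, c * ‖y‖ ^ β / (1 + ‖y‖ ^ α) := by
    calc (1 / 4 : ℝ) ^ β * M * ((1 / 4) ^ N * v)
        = ∫ _ in ball z (r / 4), (1 / 4 : ℝ) ^ β * M := by
          rw [setIntegral_const, smul_eq_mul, Measure.real, hvz]; ring
      _ ≤ ∫ y in ball z (r / 4), c * ‖y‖ ^ β / (1 + ‖y‖ ^ α) := by
          apply setIntegral_mono_on (integrableOn_const measure_ball_lt_top.ne) (hint.mono_set hsub)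
            measurableSet_ball
          intro y hy
          refine (aux_scale α β c hα hc R hRpos.le).trans ?_
          apply aux_mono α β c hα hβ hc _ _ (by positivity)
          have h1 : ‖y - z‖ < r / 4 := by simpa [dist_eq_norm] using hy
          have h2 := norm_le_norm_add_norm_sub y z
          have h3 := norm_nonneg x
          linarith
      _ ≤ _ := setIntegral_mono_set hint
          (Filter.Eventually.of_forall fun y => by simp only [Pi.zero_apply]; positivity)
          hsub.eventuallyLE
  have h4 : (4 : ℝ) ^ β * (1 / 4 : ℝ) ^ β = 1 := by
    rw [← mul_rpow (by norm_num) (by norm_num)]; norm_num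
  have h5 : (4 : ℝ) ^ N * (1 / 4 : ℝ) ^ N = 1 := by
    rw [← mul_pow]; norm_num
  calc M = (4 ^ N * (1 / 4 : ℝ) ^ N) * (4 ^ β * (1 / 4 : ℝ) ^ β) * M * (v⁻¹ * v) := by
        rw [h4, h5, inv_mul_cancel₀ hvpos.ne']; ring
    _ = 4 ^ N * 4 ^ β * (v⁻¹ * ((1 / 4 : ℝ) ^ β * M * ((1 / 4) ^ N * v))) := by ring
    _ ≤ _ := by gcongr
end

section
/- Let p ≥ 2 be real and λ ∈ ℝ. For every u ∈ C_c^∞(ℝ^N; ℝ) one has the identity: ∫_{ℝ^N} (1+|x|^α)^{−1} (λu(x) − Au(x)) u(x)|u(x)|^{p−2} dx = ∫_{ℝ^N} [ (λ + c|x|^β)/(1+|x|^α) + ( b(N+α−2)|x|^{α−2} + b(N−2)|x|^{2α−2} ) / ( p (1+|x|^α)² ) ] |u(x)|^p dx + (p−1) ∫_{ℝ^N} |∇u(x)|² |u(x)|^{p−2} dx. -/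
open Real MeasureTheory Metric
open scoped ENNReal NNReal

/-- The elliptic operator `Au = (1+|x|^α)Δu + b|x|^{α-2} x·∇u - c|x|^β u`. -/
noncomputable def opA {N : ℕ} (α β b c : ℝ) (u : EuclideanSpace ℝ (Fin N) → ℝ)
    (x : EuclideanSpace ℝ (Fin N)) : ℝ :=
  (1 + ‖x‖ ^ α) * lap u x + b * ‖x‖ ^ (α - 2) * (∑ i, x i * pd u i x)
    - c * ‖x‖ ^ β * u x

lemma hasFDerivAt_zero_mul {E : Type*} [NormedAddCommGroup E] [NormedSpace ℝ E]
    (g : E → ℝ) (L : E →L[ℝ] ℝ) (hg : ContinuousAt g 0) (h0 : g 0 = 0) :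
    HasFDerivAt (fun x => g x * L x) (0 : E →L[ℝ] ℝ) 0 := by
  rw [hasFDerivAt_iff_isLittleO_nhds_zero]
  have h1 : g =o[nhds 0] (fun _ => (1:ℝ)) := by
    rw [Asymptotics.isLittleO_one_iff]
    simpa [ContinuousAt, h0] using hg
  have h2 : (fun x => L x) =O[nhds 0] (fun x : E => x) := L.isBigO_id _
  have h3 := h1.mul_isBigO h2.norm_right
  simp only [one_mul] at h3
  replace h3 := h3.of_norm_right
  simpa [h0] using h3

lemma hasDerivAt_phi (p : ℝ) (hp : 2 ≤ p) (s : ℝ) :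
    HasDerivAt (fun s : ℝ => s * |s| ^ (p - 2)) ((p - 1) * |s| ^ (p - 2)) s := by
  rcases eq_or_lt_of_le hp with rfl | hp
  · norm_num
    exact hasDerivAt_id s
  rcases eq_or_ne s 0 with rfl | hs
  · have := hasFDerivAt_zero_mul (fun s : ℝ => |s| ^ (p - 2)) (ContinuousLinearMap.id ℝ ℝ)
      (by
        refine (continuous_abs.rpow_const ?_).continuousAt
        intro; right; linarith) (by simp [Real.zero_rpow (by linarith : p - 2 ≠ 0)])
    have h2 := this.hasDerivAt
    simp only [abs_zero, Real.zero_rpow (by linarith : p - 2 ≠ 0), mul_zero]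
    simpa [mul_comm] using h2
  · have h1 : HasDerivAt (fun s : ℝ => |s|) (SignType.sign s : ℝ) s := hasDerivAt_abs hs
    have h2 := (hasDerivAt_id s).mul (h1.rpow_const (p := p - 2) (Or.inl (by simpa using hs)))
    refine h2.congr_deriv ?_
    have h3 : |s| ^ (p - 2) = |s| ^ (p - 2 - 1) * |s| := by
      rw [← Real.rpow_add_one (by simpa using hs)]; congr 1; ring
    have h4 : s * (SignType.sign s : ℝ) = |s| := by simp
    simp only [id]
    rw [h3]
    linear_combination (p-2) * |s| ^ (p - 2 - 1) * h4

lemma abs_rpow_split (p : ℝ) (hp : 2 ≤ p) (s : ℝ) : s * (s * |s| ^ (p - 2)) = |s| ^ p := by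
  rw [← mul_assoc, ← abs_mul_abs_self s]
  rcases eq_or_ne s 0 with rfl | hs
  · simp [Real.zero_rpow (by linarith : p ≠ 0)]
  · have : 0 < |s| := by simpa using hs
    rw [show |s| * |s| = |s| ^ (2:ℝ) by norm_num [sq], ← Real.rpow_add this]
    congr 1; ring

lemma norm_pow_split {E : Type*} [NormedAddCommGroup E] (γ : ℝ) (hγ : 0 < γ) (x : E) :
    ‖x‖ ^ 2 * ‖x‖ ^ (γ - 2) = ‖x‖ ^ γ := by
  rcases eq_or_ne x 0 with rfl | hs
  · simp [Real.zero_rpow hγ.ne']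
  · have : 0 < ‖x‖ := by simpa using hs
    rw [show ‖x‖ ^ 2 = ‖x‖ ^ (2:ℝ) by norm_num, ← Real.rpow_add this]
    congr 1; ring

lemma hasFDerivAt_V {N : ℕ} (γ : ℝ) (hγ : 0 < γ) (i : Fin N) (x : EuclideanSpace ℝ (Fin N)) :
    HasFDerivAt (fun x : EuclideanSpace ℝ (Fin N) => ‖x‖ ^ γ * x i)
      ((γ * ‖x‖ ^ (γ - 2) * x i) • innerSL ℝ x
        + ‖x‖ ^ γ • (EuclideanSpace.proj i : EuclideanSpace ℝ (Fin N) →L[ℝ] ℝ)) x := by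
  rcases eq_or_ne x 0 with rfl | hs
  · have := hasFDerivAt_zero_mul (fun x : EuclideanSpace ℝ (Fin N) => ‖x‖ ^ γ)
      (EuclideanSpace.proj i)
      (by
        refine (continuous_norm.rpow_const ?_).continuousAt
        intro; right; linarith) (by simp [Real.zero_rpow hγ.ne'])
    simpa [Real.zero_rpow hγ.ne'] using this
  · have hn : 0 < ‖x‖ := by simpa using hs
    have h1 : HasFDerivAt (fun x : EuclideanSpace ℝ (Fin N) => ‖x‖ ^ γ)
        ((γ * ‖x‖ ^ (γ - 2)) • innerSL ℝ x) x := by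
      have h := (hasStrictFDerivAt_norm_sq x).hasFDerivAt.rpow_const (p := γ / 2)
        (Or.inl (by positivity))
      have e : (fun x : EuclideanSpace ℝ (Fin N) => ‖x‖ ^ γ) = fun x => (‖x‖ ^ 2) ^ (γ / 2) := by
        ext y
        rw [← Real.rpow_natCast, ← Real.rpow_mul (norm_nonneg _)]
        congr 1; push_cast; ring
      rw [e]
      refine h.congr_fderiv ?_
      rw [← Real.rpow_natCast, ← Real.rpow_mul (norm_nonneg _)]
      ext y
      simp
      ring_nf
    have h2 : HasFDerivAt (fun x : EuclideanSpace ℝ (Fin N) => x i)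
      (EuclideanSpace.proj i : EuclideanSpace ℝ (Fin N) →L[ℝ] ℝ) x :=
      (EuclideanSpace.proj i : EuclideanSpace ℝ (Fin N) →L[ℝ] ℝ).hasFDerivAt
    refine (h1.mul h2).congr_fderiv ?_
    ext y
    simp
    ring

lemma pd_W {N : ℕ} (α : ℝ) (hα : 2 < α) (i : Fin N) (x : EuclideanSpace ℝ (Fin N)) :
    DifferentiableAt ℝ (fun x : EuclideanSpace ℝ (Fin N) =>
        ‖x‖ ^ (α - 2) * x i * (1 + ‖x‖ ^ α)⁻¹) x ∧
    fderiv ℝ (fun x : EuclideanSpace ℝ (Fin N) => ‖x‖ ^ (α - 2) * x i * (1 + ‖x‖ ^ α)⁻¹) x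
      (EuclideanSpace.single i 1) =
      ((α - 2) * ‖x‖ ^ (α - 2 - 2) * (x i) ^ 2 + ‖x‖ ^ (α - 2)) * (1 + ‖x‖ ^ α)⁻¹
       - ‖x‖ ^ (α - 2) * α * ‖x‖ ^ (α - 2) * (x i) ^ 2 * ((1 + ‖x‖ ^ α) ^ 2)⁻¹ := by
  have hpos : 0 < 1 + ‖x‖ ^ α := by positivity
  have h1 := hasFDerivAt_V (α - 2) (by linarith) i x
  have h2 := (hasFDerivAt_norm_rpow x (p := α) (by linarith)).const_add 1
  have h3 := (hasDerivAt_inv hpos.ne').comp_hasFDerivAt x h2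
  have h4 := h1.mul h3
  refine ⟨h4.differentiableAt, ?_⟩
  refine (congrArg (fun L => L (EuclideanSpace.single i 1)) h4.fderiv).trans ?_
  simp [EuclideanSpace.inner_single_right]
  ring

lemma cont_integrable {N : ℕ} {f u : EuclideanSpace ℝ (Fin N) → ℝ} (hf : Continuous f)
    (hsupp : HasCompactSupport u) (h : ∀ x, u x = 0 → f x = 0) : Integrable f :=
  hf.integrable_of_hasCompactSupport
    (hsupp.mono (fun x hx => by
      simp only [Function.mem_support] at hx ⊢
      exact fun h' => hx (h x h')))

lemma pd_contDiff {N : ℕ} {u : EuclideanSpace ℝ (Fin N) → ℝ} (hu : ContDiff ℝ (⊤ : ℕ∞) u)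
    (i : Fin N) : ContDiff ℝ (⊤ : ℕ∞) (pd u i) := by
  unfold pd
  exact (hu.fderiv_right (m := (⊤ : ℕ∞)) (by simp)).clm_apply contDiff_const

lemma phi_fderiv {N : ℕ} (p : ℝ) (hp : 2 ≤ p) {u : EuclideanSpace ℝ (Fin N) → ℝ}
    (hu : ContDiff ℝ (⊤ : ℕ∞) u) (x : EuclideanSpace ℝ (Fin N)) :
    HasFDerivAt (fun x => u x * |u x| ^ (p - 2)) (((p - 1) * |u x| ^ (p - 2)) • fderiv ℝ u x) x :=
  (hasDerivAt_phi p hp (u x)).comp_hasFDerivAt x (hu.differentiable (by simp) x).hasFDerivAt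

lemma absp_fderiv {N : ℕ} (p : ℝ) (hp : 2 ≤ p) {u : EuclideanSpace ℝ (Fin N) → ℝ}
    (hu : ContDiff ℝ (⊤ : ℕ∞) u) (x : EuclideanSpace ℝ (Fin N)) :
    HasFDerivAt (fun x => |u x| ^ p) ((p * |u x| ^ (p - 2) * u x) • fderiv ℝ u x) x :=
  (hasDerivAt_abs_rpow (u x) (by linarith)).comp_hasFDerivAt x
    (hu.differentiable (by simp) x).hasFDerivAt

lemma cont_abs_rpow {N : ℕ} (q : ℝ) (hq : 0 ≤ q) {u : EuclideanSpace ℝ (Fin N) → ℝ}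
    (hu : Continuous u) : Continuous (fun x => |u x| ^ q) :=
  hu.abs.rpow_const (fun _ => Or.inr hq)

lemma cont_norm_rpow {N : ℕ} (q : ℝ) (hq : 0 ≤ q) :
    Continuous (fun x : EuclideanSpace ℝ (Fin N) => ‖x‖ ^ q) :=
  continuous_norm.rpow_const (fun _ => Or.inr hq)

lemma cont_inv {N : ℕ} (q : ℝ) (hq : 0 ≤ q) :
    Continuous (fun x : EuclideanSpace ℝ (Fin N) => (1 + ‖x‖ ^ q)⁻¹) :=
  (continuous_const.add (cont_norm_rpow q hq)).inv₀ (fun x => by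
    have : 0 < 1 + ‖x‖ ^ q := by positivity
    exact this.ne')

lemma pd_zero_of_support {N : ℕ} {u : EuclideanSpace ℝ (Fin N) → ℝ}
    (hsupp : HasCompactSupport u) (i : Fin N) : HasCompactSupport (pd u i) :=
  hsupp.fderiv_apply ℝ (EuclideanSpace.single i 1)

lemma partA_i {N : ℕ} (p : ℝ) (hp : 2 ≤ p) {u : EuclideanSpace ℝ (Fin N) → ℝ}
    (hu : ContDiff ℝ (⊤ : ℕ∞) u) (hsupp : HasCompactSupport u) (i : Fin N) :
    ∫ x, pd (pd u i) i x * (u x * |u x| ^ (p - 2)) =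
      - ((p - 1) * ∫ x, (pd u i x) ^ 2 * |u x| ^ (p - 2)) := by
  have c0 := cont_abs_rpow (p - 2) (by linarith) hu.continuous
  have cu := hu.continuous
  have c1 := (pd_contDiff hu i).continuous
  have c2 := (pd_contDiff (pd_contDiff hu i) i).continuous
  have key := integral_mul_fderiv_eq_neg_fderiv_mul_of_integrable (μ := volume)
    (f := fun x => u x * |u x| ^ (p - 2)) (g := pd u i) (v := EuclideanSpace.single i 1)
    (by
      simp only [(phi_fderiv p hp hu _).fderiv]
      refine cont_integrable (u := pd u i) ?_ (pd_zero_of_support hsupp i) (fun x hx => by simp [hx])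
      exact ((continuous_const.mul c0).mul c1).mul c1)
    (cont_integrable (u := u) ((cu.mul c0).mul c2) hsupp (fun x hx => by simp [hx]))
    (cont_integrable (u := u) ((cu.mul c0).mul c1) hsupp (fun x hx => by simp [hx]))
    (fun x _ => (phi_fderiv p hp hu x).differentiableAt)
    (fun x _ => (pd_contDiff hu i).differentiable (by simp) x)
  simp only [(phi_fderiv p hp hu _).fderiv] at key
  rw [← integral_const_mul]
  refine Eq.trans ?_ (key.trans ?_)
  · congr 1; ext x; simp only [pd]; ring
  · congr 2; ext x; simp [pd]; ring

lemma partA {N : ℕ} (p : ℝ) (hp : 2 ≤ p) {u : EuclideanSpace ℝ (Fin N) → ℝ}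
    (hu : ContDiff ℝ (⊤ : ℕ∞) u) (hsupp : HasCompactSupport u) :
    ∫ x, lap u x * (u x * |u x| ^ (p - 2)) =
      - ((p - 1) * ∫ x, (∑ i, (pd u i x) ^ 2) * |u x| ^ (p - 2)) := by
  have c0 := cont_abs_rpow (p - 2) (by linarith) hu.continuous
  simp only [lap, Finset.sum_mul]
  rw [integral_finsetSum, integral_finsetSum, Finset.mul_sum, ← Finset.sum_neg_distrib]
  · exact Finset.sum_congr rfl (fun i _ => partA_i p hp hu hsupp i)
  · intro i _
    exact cont_integrable (u := pd u i) (((pd_contDiff hu i).continuous.pow 2).mul c0)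
      (pd_zero_of_support hsupp i) (fun x hx => by simp [hx])
  · intro i _
    exact cont_integrable (u := u) ((pd_contDiff (pd_contDiff hu i) i).continuous.mul
      (hu.continuous.mul c0)) hsupp (fun x hx => by simp [hx])

lemma coord_cont {N : ℕ} (i : Fin N) : Continuous (fun x : EuclideanSpace ℝ (Fin N) => x i) :=
  (EuclideanSpace.proj i : EuclideanSpace ℝ (Fin N) →L[ℝ] ℝ).continuous

lemma intB {N : ℕ} (α p : ℝ) (hα : 2 < α) (hp : 2 ≤ p) {u : EuclideanSpace ℝ (Fin N) → ℝ}
    (hu : ContDiff ℝ (⊤ : ℕ∞) u) (hsupp : HasCompactSupport u) (i : Fin N) :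
    Integrable (fun x : EuclideanSpace ℝ (Fin N) =>
      (((α - 2) * ‖x‖ ^ (α - 2 - 2) * (x i) ^ 2 + ‖x‖ ^ (α - 2)) * (1 + ‖x‖ ^ α)⁻¹
       - ‖x‖ ^ (α - 2) * α * ‖x‖ ^ (α - 2) * (x i) ^ 2 * ((1 + ‖x‖ ^ α) ^ 2)⁻¹) * |u x| ^ p) := by
  have c0 := cont_abs_rpow p (by linarith) hu.continuous
  have c1 := cont_norm_rpow (N := N) (α - 2) (by linarith)
  have c2 := cont_inv (N := N) α (by linarith)
  have c3 := coord_cont i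
  have hz : ∀ x, u x = 0 → |u x| ^ p = 0 := fun x hx => by
    simp [hx, Real.zero_rpow (by linarith : p ≠ 0)]
  have I1 : Integrable (fun x : EuclideanSpace ℝ (Fin N) =>
      (‖x‖ ^ (α - 2) * (1 + ‖x‖ ^ α)⁻¹
       - ‖x‖ ^ (α - 2) * α * ‖x‖ ^ (α - 2) * (x i) ^ 2 * ((1 + ‖x‖ ^ α)⁻¹) ^ 2) * |u x| ^ p) :=
    cont_integrable (u := u) (by fun_prop) hsupp (fun x hx => by simp [hz x hx])
  have I2 : Integrable (fun x : EuclideanSpace ℝ (Fin N) =>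
      (α - 2) * ‖x‖ ^ (α - 2) * (1 + ‖x‖ ^ α)⁻¹ * |u x| ^ p) :=
    cont_integrable (u := u) (by fun_prop) hsupp (fun x hx => by simp [hz x hx])
  have I3 : Integrable (fun x : EuclideanSpace ℝ (Fin N) =>
      (α - 2) * (‖x‖ ^ (α - 2 - 2) * (x i) ^ 2) * (1 + ‖x‖ ^ α)⁻¹ * |u x| ^ p) := by
    refine I2.mono' ?_ (Filter.Eventually.of_forall fun x => ?_)
    · apply Measurable.aestronglyMeasurable
      have m0 := c0.measurable
      have m2 := c2.measurable
      have m3 := c3.measurable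
      have m4 : Measurable (fun x : EuclideanSpace ℝ (Fin N) => ‖x‖ ^ (α - 2 - 2)) :=
        measurable_norm.pow_const _
      fun_prop
    · have hh : 0 < α - 2 := by linarith
      rw [Real.norm_of_nonneg (by positivity)]
      have : ‖x‖ ^ (α - 2 - 2) * (x i) ^ 2 ≤ ‖x‖ ^ (α - 2) := by
        rw [← norm_pow_split (α - 2) hh x, mul_comm]
        refine mul_le_mul_of_nonneg_right ?_ (by positivity)
        rw [EuclideanSpace.real_norm_sq_eq]
        exact Finset.single_le_sum (f := fun i => (x i) ^ 2) (fun _ _ => sq_nonneg _)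
          (Finset.mem_univ i)
      gcongr
  refine (I3.add I1).congr (Filter.Eventually.of_forall fun x => ?_)
  simp only [Pi.add_apply, inv_pow]
  ring

lemma partB_i {N : ℕ} (α p : ℝ) (hα : 2 < α) (hp : 2 ≤ p) {u : EuclideanSpace ℝ (Fin N) → ℝ}
    (hu : ContDiff ℝ (⊤ : ℕ∞) u) (hsupp : HasCompactSupport u) (i : Fin N) :
    p * ∫ x, ‖x‖ ^ (α - 2) * (1 + ‖x‖ ^ α)⁻¹ * (x i * pd u i x) * (u x * |u x| ^ (p - 2)) =
      - ∫ x, (((α - 2) * ‖x‖ ^ (α - 2 - 2) * (x i) ^ 2 + ‖x‖ ^ (α - 2)) * (1 + ‖x‖ ^ α)⁻¹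
       - ‖x‖ ^ (α - 2) * α * ‖x‖ ^ (α - 2) * (x i) ^ 2 * ((1 + ‖x‖ ^ α) ^ 2)⁻¹) * |u x| ^ p := by
  have c0 := cont_abs_rpow p (by linarith) hu.continuous
  have c0' := cont_abs_rpow (p - 2) (by linarith) hu.continuous
  have c1 := cont_norm_rpow (N := N) (α - 2) (by linarith)
  have c2 := cont_inv (N := N) α (by linarith)
  have c3 := coord_cont i
  have c4 := (pd_contDiff hu i).continuous
  have cu := hu.continuous
  have hz : ∀ x, u x = 0 → |u x| ^ p = 0 := fun x hx => by
    simp [hx, Real.zero_rpow (by linarith : p ≠ 0)]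
  have key := integral_mul_fderiv_eq_neg_fderiv_mul_of_integrable (μ := volume)
    (f := fun x : EuclideanSpace ℝ (Fin N) => ‖x‖ ^ (α - 2) * x i * (1 + ‖x‖ ^ α)⁻¹)
    (g := fun x => |u x| ^ p) (v := EuclideanSpace.single i 1)
    (by
      simp only [(pd_W α hα i _).2]
      exact intB α p hα hp hu hsupp i)
    (by
      simp only [(absp_fderiv p hp hu _).fderiv]
      refine cont_integrable (u := u) ?_ hsupp (fun x hx => by simp [hx])
      exact ((c1.mul c3).mul c2).mul (((continuous_const.mul c0').mul cu).mul c4))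
    (cont_integrable (u := u) (by fun_prop) hsupp (fun x hx => by simp [hz x hx]))
    (fun x _ => (pd_W α hα i x).1)
    (fun x _ => (absp_fderiv p hp hu x).differentiableAt)
  simp only [(pd_W α hα i _).2, (absp_fderiv p hp hu _).fderiv] at key
  rw [← key, ← integral_const_mul]
  congr 1; ext x; simp [pd]; ring

lemma partB {N : ℕ} (α p : ℝ) (hα : 2 < α) (hp : 2 ≤ p) {u : EuclideanSpace ℝ (Fin N) → ℝ}
    (hu : ContDiff ℝ (⊤ : ℕ∞) u) (hsupp : HasCompactSupport u) :
    p * ∫ x, ‖x‖ ^ (α - 2) * (1 + ‖x‖ ^ α)⁻¹ * (∑ i, x i * pd u i x) * (u x * |u x| ^ (p - 2)) =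
      - ∫ x, (((N : ℝ) + α - 2) * ‖x‖ ^ (α - 2) + ((N : ℝ) - 2) * ‖x‖ ^ (2 * α - 2))
            / (1 + ‖x‖ ^ α) ^ 2 * |u x| ^ p := by
  have c0' := cont_abs_rpow (p - 2) (by linarith) hu.continuous
  have c1 := cont_norm_rpow (N := N) (α - 2) (by linarith)
  have c2 := cont_inv (N := N) α (by linarith)
  have cu := hu.continuous
  simp only [Finset.mul_sum, Finset.sum_mul]
  rw [integral_finsetSum, Finset.mul_sum]
  · simp only [partB_i α p hα hp hu hsupp]
    rw [Finset.sum_neg_distrib, ← integral_finsetSum]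
    · congr 2; ext x
      rw [← Finset.sum_mul]
      congr 1
      have hpos : 0 < 1 + ‖x‖ ^ α := by positivity
      have e := EuclideanSpace.real_norm_sq_eq x
      have e1 := norm_pow_split (α - 2) (by linarith) x
      have e2 := norm_pow_split α (by linarith) x
      have e3 : ‖x‖ ^ (2 * α - 2) = ‖x‖ ^ α * ‖x‖ ^ (α - 2) := by
        rcases eq_or_ne x 0 with rfl | hs
        · simp [Real.zero_rpow (by linarith : α ≠ 0), Real.zero_rpow (by linarith : 2 * α - 2 ≠ 0)]
        · rw [← Real.rpow_add (by simpa using hs)]; congr 1; ring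
      rw [Finset.sum_sub_distrib, ← Finset.sum_mul, ← Finset.sum_mul, Finset.sum_add_distrib,
        ← Finset.mul_sum, ← Finset.mul_sum, ← e, e3]
      simp only [Finset.sum_const, Finset.card_univ, Fintype.card_fin, nsmul_eq_mul]
      rw [show (α - 2) * ‖x‖ ^ (α - 2 - 2) * ‖x‖ ^ 2 = (α - 2) * ‖x‖ ^ (α - 2) by rw [← e1]; ring,
        show ‖x‖ ^ (α - 2) * α * ‖x‖ ^ (α - 2) * ‖x‖ ^ 2 = α * ‖x‖ ^ (α - 2) * ‖x‖ ^ α by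
          rw [← e2]; ring]
      field_simp
      ring
    · intro i _
      exact intB α p hα hp hu hsupp i
  · intro i _
    have c3 := coord_cont i
    have c4 := (pd_contDiff hu i).continuous
    exact cont_integrable (u := u) (by fun_prop) hsupp (fun x hx => by simp [hx])

/-- For real `p ≥ 2`, `λ ∈ ℝ` and `u ∈ C_c^∞(ℝ^N; ℝ)`:
`∫ (1+|x|^α)⁻¹ (λu - Au) u|u|^{p-2}
  = ∫ [(λ + c|x|^β)/(1+|x|^α) + (b(N+α-2)|x|^{α-2} + b(N-2)|x|^{2α-2})/(p(1+|x|^α)²)] |u|^p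
    + (p-1) ∫ |∇u|² |u|^{p-2}`. -/
theorem stmt19 (N : ℕ) (hN : 2 < N) (α β b c p lam : ℝ) (hα : 2 < α) (hβ : α - 2 < β)
    (hc : 0 < c) (hp : 2 ≤ p)
    (u : EuclideanSpace ℝ (Fin N) → ℝ) (hu : ContDiff ℝ (⊤ : ℕ∞) u) (hsupp : HasCompactSupport u) :
    ∫ x, (1 + ‖x‖ ^ α)⁻¹ * (lam * u x - opA α β b c u x) * (u x * |u x| ^ (p - 2)) =
      (∫ x, ((lam + c * ‖x‖ ^ β) / (1 + ‖x‖ ^ α)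
          + (b * ((N : ℝ) + α - 2) * ‖x‖ ^ (α - 2) + b * ((N : ℝ) - 2) * ‖x‖ ^ (2 * α - 2))
            / (p * (1 + ‖x‖ ^ α) ^ 2)) * |u x| ^ p)
      + (p - 1) * ∫ x, (∑ i, (pd u i x) ^ 2) * |u x| ^ (p - 2) := by
  have c0 := cont_abs_rpow p (by linarith) hu.continuous
  have c0' := cont_abs_rpow (p - 2) (by linarith) hu.continuous
  have c1 := cont_norm_rpow (N := N) (α - 2) (by linarith)
  have c1' := cont_norm_rpow (N := N) (2 * α - 2) (by linarith)
  have c1'' := cont_norm_rpow (N := N) β (by linarith)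
  have c2 := cont_inv (N := N) α (by linarith)
  have cu := hu.continuous
  have c5 : Continuous (lap u) :=
    continuous_finsetSum _ fun i _ => (pd_contDiff (pd_contDiff hu i) i).continuous
  have c6 : Continuous (fun x : EuclideanSpace ℝ (Fin N) => ∑ i, x i * pd u i x) :=
    continuous_finsetSum _ fun i _ => (coord_cont i).mul (pd_contDiff hu i).continuous
  have hz : ∀ x, u x = 0 → |u x| ^ p = 0 := fun x hx => by
    simp [hx, Real.zero_rpow (by linarith : p ≠ 0)]
  have hA := partA p hp hu hsupp
  have hB := partB α p hα hp hu hsupp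
  have I1 : Integrable (fun x => (lam + c * ‖x‖ ^ β) * (1 + ‖x‖ ^ α)⁻¹ * |u x| ^ p) :=
    cont_integrable (u := u) (by fun_prop) hsupp (fun x hx => by simp [hz x hx])
  have I2 : Integrable (fun x => lap u x * (u x * |u x| ^ (p - 2))) :=
    cont_integrable (u := u) (by fun_prop) hsupp (fun x hx => by simp [hx])
  have I3 : Integrable (fun x => ‖x‖ ^ (α - 2) * (1 + ‖x‖ ^ α)⁻¹ * (∑ i, x i * pd u i x)
      * (u x * |u x| ^ (p - 2))) :=
    cont_integrable (u := u) (((c1.mul c2).mul c6).mul (cu.mul c0')) hsupp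
      (fun x hx => by simp [hx])
  have I4 : Integrable (fun x => (((N : ℝ) + α - 2) * ‖x‖ ^ (α - 2)
      + ((N : ℝ) - 2) * ‖x‖ ^ (2 * α - 2)) / (1 + ‖x‖ ^ α) ^ 2 * |u x| ^ p) := by
    simp only [div_eq_mul_inv, ← inv_pow]
    exact cont_integrable (u := u) (by fun_prop) hsupp (fun x hx => by simp [hz x hx])
  have hL : ∀ x, (1 + ‖x‖ ^ α)⁻¹ * (lam * u x - opA α β b c u x) * (u x * |u x| ^ (p - 2)) =
      (lam + c * ‖x‖ ^ β) * (1 + ‖x‖ ^ α)⁻¹ * |u x| ^ p - lap u x * (u x * |u x| ^ (p - 2))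
      - b * (‖x‖ ^ (α - 2) * (1 + ‖x‖ ^ α)⁻¹ * (∑ i, x i * pd u i x)
      * (u x * |u x| ^ (p - 2))) := by
    intro x
    have hpos : 0 < 1 + ‖x‖ ^ α := by positivity
    rw [← abs_rpow_split p hp (u x), opA]
    field_simp
    ring
  have hR : ∀ x, ((lam + c * ‖x‖ ^ β) / (1 + ‖x‖ ^ α)
          + (b * ((N : ℝ) + α - 2) * ‖x‖ ^ (α - 2) + b * ((N : ℝ) - 2) * ‖x‖ ^ (2 * α - 2))
            / (p * (1 + ‖x‖ ^ α) ^ 2)) * |u x| ^ p =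
      (lam + c * ‖x‖ ^ β) * (1 + ‖x‖ ^ α)⁻¹ * |u x| ^ p
      + (b / p) * ((((N : ℝ) + α - 2) * ‖x‖ ^ (α - 2)
      + ((N : ℝ) - 2) * ‖x‖ ^ (2 * α - 2)) / (1 + ‖x‖ ^ α) ^ 2 * |u x| ^ p) := by
    intro x
    have hpos : 0 < 1 + ‖x‖ ^ α := by positivity
    have : p ≠ 0 := by linarith
    field_simp
  simp only [hL, hR]
  have I12 : Integrable (fun x => (lam + c * ‖x‖ ^ β) * (1 + ‖x‖ ^ α)⁻¹ * |u x| ^ p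
      - lap u x * (u x * |u x| ^ (p - 2))) := I1.sub I2
  rw [integral_sub I12 (I3.const_mul b), integral_sub I1 I2,
    integral_add I1 (I4.const_mul _), integral_const_mul, integral_const_mul, hA]
  have : p ≠ 0 := by linarith
  have hB' := neg_eq_iff_eq_neg.mpr hB
  rw [← hB']
  field_simp
  ring
end
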